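/- arXiv:2309.02747 — 2 statements merged into one kernel-verified Lean document; each statement's English description precedes it below -/
import Mathlib

section
/- The family of languages accepted by reversible deterministic two-party Watson-Crick systems is not closed under union. -/
namespace WK

/-- Tape symbols: input symbols plus the two endmarkers.
`Sum.inr false` is the left endmarker, `Sum.inr true` the right endmarker. -/
abbrev TSym (α : Type) : Type := α ⊕ Bool

/-- The tape for input `w`: left endmarker, the symbols of `w`, right endmarker. -/
def tape {α : Type} (w : List α) (k : ℕ) : TSym α :=
  ((Sum.inr false :: w.map Sum.inl) ++ [Sum.inr true]).getD k (Sum.inr true)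

/-- A deterministic two-party Watson-Crick system: two finite automata (the upper
component `1` and the lower component `2`) with a finite set `M` of messages,
partial transition functions `δᵢ` (depending on state, scanned symbol and received
message, `none` = no message) and broadcast functions `μᵢ`. -/
structure DPWK (α : Type) where
  M : Type
  Q1 : Type
  Q2 : Type
  fM : Fintype M
  fQ1 : Fintype Q1
  fQ2 : Fintype Q2
  δ1 : Q1 → TSym α → Option M → Option (Q1 × Bool)
  δ2 : Q2 → TSym α → Option M → Option (Q2 × Bool)
  μ1 : Q1 → TSym α → Option M
  μ2 : Q2 → TSym α → Option M
  q01 : Q1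
  q02 : Q2
  F1 : Set Q1
  F2 : Set Q2

/-- A configuration: states and head positions of the two components. -/
structure Config {α : Type} (A : DPWK α) where
  p : A.Q1
  i : ℕ
  q : A.Q2
  j : ℕ

/-- One synchronous (forward) computation step: each component reads its symbol,
receives the message broadcast by the other component, changes its state and
optionally moves (the upper head to the right, the lower head to the left). -/
def Step {α : Type} (A : DPWK α) (w : List α) (c c' : Config A) : Prop :=
  ∃ d1 d2 : Bool,
    A.δ1 c.p (tape w c.i) (A.μ2 c.q (tape w c.j)) = some (c'.p, d1) ∧
    A.δ2 c.q (tape w c.j) (A.μ1 c.p (tape w c.i)) = some (c'.q, d2) ∧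
    c'.i = c.i + (cond d1 1 0) ∧ c.j = c'.j + (cond d2 1 0)

/-- The initial configuration on input `w`: the upper component on the left
endmarker, the lower component on the right endmarker. -/
def initConf {α : Type} (A : DPWK α) (w : List α) : Config A :=
  ⟨A.q01, 0, A.q02, w.length + 1⟩

/-- The system halts in `c` if no successor configuration exists. -/
def Halted {α : Type} (A : DPWK α) (w : List α) (c : Config A) : Prop :=
  ¬ ∃ c', Step A w c c'

/-- A configuration is accepting if at least one component is in an accepting state. -/
def AccConf {α : Type} (A : DPWK α) (c : Config A) : Prop :=
  c.p ∈ A.F1 ∨ c.q ∈ A.F2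

/-- `cs` is an accepting computation of `A` on `w`: it starts in the initial
configuration, follows the step relation, and ends in a halting configuration
with at least one component in an accepting state. -/
def AccComp {α : Type} (A : DPWK α) (w : List α) (cs : List (Config A)) : Prop :=
  cs.head? = some (initConf A w) ∧ List.Chain' (Step A w) cs ∧
    ∃ c, cs.getLast? = some c ∧ Halted A w c ∧ AccConf A c

def Accepts {α : Type} (A : DPWK α) (w : List α) : Prop := ∃ cs, AccComp A w cs

/-- The language accepted by `A`. -/
def lang {α : Type} (A : DPWK α) : Set (List α) := { w | Accepts A w }

/-- One backward computation step, induced by reverse transition functions `δ'ᵢ` and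
reverse broadcast functions `μ'ᵢ`: the heads first move to their predecessor
positions (the upper head left, the lower head right) and then read the symbols there. -/
def BackStep {α : Type} (A : DPWK α)
    (δ'1 : A.Q1 → TSym α → Option A.M → Option (A.Q1 × Bool))
    (δ'2 : A.Q2 → TSym α → Option A.M → Option (A.Q2 × Bool))
    (μ'1 : A.Q1 → TSym α → Option A.M)
    (μ'2 : A.Q2 → TSym α → Option A.M)
    (w : List α) (c' c : Config A) : Prop :=
  ∃ d1 d2 : Bool,
    δ'1 c'.p (tape w c.i) (μ'2 c'.q (tape w c.j)) = some (c.p, d1) ∧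
    δ'2 c'.q (tape w c.j) (μ'1 c'.p (tape w c.i)) = some (c.q, d2) ∧
    c'.i = c.i + (cond d1 1 0) ∧ c.j = c'.j + (cond d2 1 0)

/-- A witness of reversibility: reverse transition and broadcast functions whose
induced backward step relation is exactly the inverse of the forward step relation,
so every configuration has at most one predecessor, computable by such a system. -/
structure RevWitness {α : Type} (A : DPWK α) where
  δ'1 : A.Q1 → TSym α → Option A.M → Option (A.Q1 × Bool)
  δ'2 : A.Q2 → TSym α → Option A.M → Option (A.Q2 × Bool)
  μ'1 : A.Q1 → TSym α → Option A.M
  μ'2 : A.Q2 → TSym α → Option A.M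
  inverse : ∀ (w : List α) (c c' : Config A),
    BackStep A δ'1 δ'2 μ'1 μ'2 w c' c ↔ Step A w c c'

/-- A reversible deterministic two-party Watson-Crick system (REV-PWK). -/
def Reversible {α : Type} (A : DPWK α) : Prop := Nonempty (RevWitness A)

/-- Number of messages (`0`, `1` or `2`) broadcast in one step from configuration `c`,
with respect to broadcast functions `μ1`, `μ2`. -/
def stepMsgs {α : Type} (A : DPWK α)
    (μ1 : A.Q1 → TSym α → Option A.M) (μ2 : A.Q2 → TSym α → Option A.M)
    (w : List α) (c : Config A) : ℕ :=
  ((μ1 c.p (tape w c.i)).elim 0 fun _ => 1) + ((μ2 c.q (tape w c.j)).elim 0 fun _ => 1)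

/-- Total number of messages sent during the computation `cs` (no messages are
sent from the final, halting configuration). -/
def commCount {α : Type} (A : DPWK α)
    (μ1 : A.Q1 → TSym α → Option A.M) (μ2 : A.Q2 → TSym α → Option A.M)
    (w : List α) (cs : List (Config A)) : ℕ :=
  (cs.dropLast.map (stepMsgs A μ1 μ2 w)).sum

/-- `A` is a reversible system that is communication bounded by `f`: it is reversible
and every word of its language is accepted by a computation in which the number of
messages sent in the forward computation and in the reverse computation are each at
most `f` of the input length. -/
def RevCommBounded {α : Type} (A : DPWK α) (f : ℕ → ℕ) : Prop :=
  ∃ Wit : RevWitness A, ∀ w ∈ lang A, ∃ cs, AccComp A w cs ∧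
    commCount A A.μ1 A.μ2 w cs ≤ f w.length ∧
    commCount A Wit.μ'1 Wit.μ'2 w cs.reverse ≤ f w.length

/-- `A` (not necessarily reversible) is communication bounded by `f`. -/
def CommBounded {α : Type} (A : DPWK α) (f : ℕ → ℕ) : Prop :=
  ∀ w ∈ lang A, ∃ cs, AccComp A w cs ∧ commCount A A.μ1 A.μ2 w cs ≤ f w.length

/-- The family of languages accepted by reversible deterministic two-party
Watson-Crick systems over the alphabet `α`. -/
def RevPWKLangs (α : Type) : Set (Set (List α)) :=
  { L | ∃ A : DPWK α, Reversible A ∧ lang A = L }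

/-- Languages accepted by REV-PWKs with `O(f)` communication. -/
def RevPWKLangsO (α : Type) (f : ℕ → ℕ) : Set (Set (List α)) :=
  { L | ∃ (A : DPWK α) (C : ℕ),
      RevCommBounded A (fun n => C * f n + C) ∧ lang A = L }

/-- Languages accepted by (possibly irreversible) DPWKs with `O(f)` communication. -/
def PWKLangsO (α : Type) (f : ℕ → ℕ) : Set (Set (List α)) :=
  { L | ∃ (A : DPWK α) (C : ℕ),
      CommBounded A (fun n => C * f n + C) ∧ lang A = L }

end WK

namespace WK

/-! ### Part 1: the reversible machines -/

/-- the symbol `1` on the tape -/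
abbrev one : TSym Bool := Sum.inl true

/-- Joint transition function. -/
def jF (r : ℕ) (k : Option (ZMod r)) (a b : TSym Bool) : Option (Option (ZMod r) × Bool × Bool) :=
  match k with
  | none => none
  | some k => if k = 0 ∧ a = one ∧ b = one then some (none, false, false)
      else some (some (k + 1), decide (k + 1 = 0), true)

/-- Joint reverse transition function. -/
def jG (r : ℕ) (k : Option (ZMod r)) (a b : TSym Bool) : Option (Option (ZMod r) × Bool × Bool) :=
  match k with
  | none => if a = one ∧ b = one then some (some 0, false, false) else none
  | some k => if k - 1 = 0 ∧ a = one ∧ b = one then none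
      else some (some (k - 1), decide (k = 0), true)

theorem jF_pos (r : ℕ) (k : ZMod r) (a b : TSym Bool) (h : k = 0 ∧ a = one ∧ b = one) :
    jF r (some k) a b = some (none, false, false) := by
  simp only [jF]; rw [if_pos h]

theorem jF_neg (r : ℕ) (k : ZMod r) (a b : TSym Bool) (h : ¬ (k = 0 ∧ a = one ∧ b = one)) :
    jF r (some k) a b = some (some (k + 1), decide (k + 1 = 0), true) := by
  simp only [jF]; rw [if_neg h]

theorem jF_jG (r : ℕ) (q q' : Option (ZMod r)) (a b : TSym Bool) (d1 d2 : Bool) :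
    jG r q' a b = some (q, d1, d2) ↔ jF r q a b = some (q', d1, d2) := by
  rcases q with _ | q <;> rcases q' with _ | q'
  · simp [jF, jG]
  · simp [jF, jG]
  · simp only [jF, jG]
    split_ifs <;> simp_all <;> aesop
  · simp only [jF, jG]
    have hq : q' - 1 = q ↔ q + 1 = q' := by
      constructor
      · rintro rfl; ring
      · rintro rfl; ring
    by_cases h : q + 1 = q'
    · have h' := hq.2 h
      rw [h', h]
      split_ifs <;> simp
    · have h' : ¬ (q' - 1 = q) := fun e => h (hq.1 e)
      split_ifs <;> simp [h, h']

def mach (r : ℕ) [NeZero r] : DPWK Bool where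
  M := Option (ZMod r) × TSym Bool
  Q1 := Option (ZMod r)
  Q2 := Option (ZMod r)
  fM := inferInstance
  fQ1 := inferInstance
  fQ2 := inferInstance
  δ1 p a m := m.bind fun x => if p = x.1 then (jF r p a x.2).map (fun y => (y.1, y.2.1)) else none
  δ2 q b m := m.bind fun x => if x.1 = q then (jF r q x.2 b).map (fun y => (y.1, y.2.2)) else none
  μ1 p a := some (p, a)
  μ2 p a := some (p, a)
  q01 := some 0
  q02 := some 0
  F1 := {none}
  F2 := {none}

theorem mach_step (r : ℕ) [NeZero r] (w : List Bool) (c c' : Config (mach r)) :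
    Step (mach r) w c c' ↔ c.p = c.q ∧ c'.p = c'.q ∧ ∃ d1 d2 : Bool,
      jF r c.p (tape w c.i) (tape w c.j) = some (c'.p, d1, d2) ∧
      c'.i = c.i + (cond d1 1 0) ∧ c.j = c'.j + (cond d2 1 0) := by
  obtain ⟨p, i, q, j⟩ := c
  obtain ⟨p', i', q', j'⟩ := c'
  change Option (ZMod r) at p q p' q'
  simp only [Step, mach, Option.bind_some]
  constructor
  · rintro ⟨d1, d2, h1, h2, h3, h4⟩
    have hpq : p = q := by
      by_contra hne
      simp [hne] at h1
    subst hpq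
    simp only [if_true] at h1 h2
    rw [Option.map_eq_some_iff] at h1 h2
    obtain ⟨⟨a, b, c⟩, e1, e2⟩ := h1
    obtain ⟨⟨a', b', c'⟩, e1', e2'⟩ := h2
    rw [e1] at e1'
    simp only [Option.some.injEq, Prod.mk.injEq] at e1' e2 e2'
    refine ⟨rfl, ?_, d1, d2, ?_, h3, h4⟩
    · rw [← e2.1, ← e2'.1, e1'.1]
    · rw [e1, ← e2.1, ← e2.2, ← e2'.2, e1'.2.2]
  · rintro ⟨rfl, h2, d1, d2, h, h3, h4⟩
    refine ⟨d1, d2, ?_, ?_, h3, h4⟩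
    · simp [h]
    · simp [h, h2]

theorem mach_rev (r : ℕ) [NeZero r] : Reversible (mach r) := by
  refine ⟨⟨fun (p : Option (ZMod r)) a m => m.bind fun (x : Option (ZMod r) × TSym Bool) =>
        if p = x.1 then (jG r p a x.2).map (fun y => (y.1, y.2.1)) else none,
      fun (q : Option (ZMod r)) b m => m.bind fun (x : Option (ZMod r) × TSym Bool) =>
        if x.1 = q then (jG r q x.2 b).map (fun y => (y.1, y.2.2)) else none,
      fun p a => some (p, a), fun p a => some (p, a), ?_⟩⟩
  intro w c c'
  rw [mach_step]
  obtain ⟨p, i, q, j⟩ := c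
  obtain ⟨p', i', q', j'⟩ := c'
  change Option (ZMod r) at p q p' q'
  simp only [BackStep, mach, Option.bind_some]
  constructor
  · rintro ⟨d1, d2, h1, h2, h3, h4⟩
    have hpq : p' = q' := by
      by_contra hne
      simp [hne] at h1
    subst hpq
    simp only [if_true] at h1 h2
    rw [Option.map_eq_some_iff] at h1 h2
    obtain ⟨⟨a, b, c⟩, e1, e2⟩ := h1
    obtain ⟨⟨a', b', c'⟩, e1', e2'⟩ := h2
    rw [e1] at e1'
    simp only [Option.some.injEq, Prod.mk.injEq] at e1' e2 e2'
    refine ⟨?_, rfl, d1, d2, ?_, h3, h4⟩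
    · rw [← e2.1, ← e2'.1, e1'.1]
    · rw [← jF_jG, e1, ← e2.1, ← e2.2, ← e2'.2, e1'.2.2]
  · rintro ⟨h2, rfl, d1, d2, h, h3, h4⟩
    rw [← jF_jG] at h
    refine ⟨d1, d2, ?_, ?_, h3, h4⟩
    · simp [h]
    · simp [h, h2]

theorem accepts_iff {α : Type} (A : DPWK α) (w : List α) :
    Accepts A w ↔ ∃ c, Relation.ReflTransGen (Step A w) (initConf A w) c ∧
      Halted A w c ∧ AccConf A c := by
  constructor
  · rintro ⟨cs, h0, h1, c, h2, h3, h4⟩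
    refine ⟨c, ?_, h3, h4⟩
    obtain ⟨l, rfl⟩ : ∃ l, cs = initConf A w :: l := by
      cases cs with
      | nil => simp at h0
      | cons a l => simp at h0; exact ⟨l, by rw [h0]⟩
    have hne : (initConf A w :: l) ≠ [] := by simp
    have := List.relationReflTransGen_of_exists_isChain_cons l h1
      (b := c) (by
        rw [List.getLast?_eq_getLast_of_ne_nil hne] at h2
        exact Option.some.inj h2)
    exact this
  · rintro ⟨c, h, h3, h4⟩
    obtain ⟨l, hl, he⟩ := List.exists_isChain_cons_of_relationReflTransGen h
    refine ⟨initConf A w :: l, rfl, hl, c, ?_, h3, h4⟩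
    rw [List.getLast?_eq_getLast_of_ne_nil (by simp), he]

/-- configuration after `s` steps -/
def mconf (r : ℕ) [NeZero r] (w : List Bool) (s : ℕ) : Config (mach r) :=
  ⟨(some (s : ZMod r) : Option (ZMod r)), s / r, (some (s : ZMod r) : Option (ZMod r)),
    w.length + 1 - s⟩

/-- Acceptance condition -/
def Trig (r : ℕ) (w : List Bool) (t : ℕ) : Prop :=
  tape w t = one ∧ r * t ≤ w.length + 1 ∧ tape w (w.length + 1 - r * t) = one

theorem mconf_step (r : ℕ) [NeZero r] (w : List Bool) (s : ℕ) (hs : s ≤ w.length + 1)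
    (c : Config (mach r)) (h : Step (mach r) w (mconf r w s) c) :
    (s ≤ w.length ∧ c = mconf r w (s + 1)) ∨
      (∃ t, Trig r w t) := by
  rw [mach_step] at h
  obtain ⟨-, h2, d1, d2, h3, h4, h5⟩ := h
  obtain ⟨p, i, q, j⟩ := c
  change Option (ZMod r) at p q
  change p = q at h2
  change jF r (some (s : ZMod r)) (tape w (s / r)) (tape w (w.length + 1 - s)) = some (p, d1, d2) at h3
  change i = s / r + _ at h4
  change w.length + 1 - s = j + _ at h5
  subst h2
  by_cases hc : ((s : ZMod r) = 0 ∧ tape w (s / r) = one ∧ tape w (w.length + 1 - s) = one)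
  · right
    refine ⟨s / r, hc.2.1, ?_, ?_⟩
    · exact (Nat.mul_div_le s r).trans hs
    · have : r ∣ s := (ZMod.natCast_eq_zero_iff s r).1 hc.1
      rw [Nat.mul_div_cancel' this]
      exact hc.2.2
  · left
    rw [jF_neg r _ _ _ hc] at h3
    simp only [Option.some.injEq, Prod.mk.injEq] at h3
    obtain ⟨rfl, rfl, rfl⟩ := h3
    simp only [cond_true] at h5
    refine ⟨by omega, ?_⟩
    simp only [mconf]
    congr 1
    · push_cast; rfl
    · rw [h4, Nat.succ_div]
      have : ((s : ZMod r) + 1 = 0) ↔ r ∣ s + 1 := by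
        rw [← ZMod.natCast_eq_zero_iff]; push_cast; rfl
      by_cases hh : r ∣ s + 1
      · simp [hh, this]
      · simp [hh, this]
    · push_cast; rfl
    · omega

theorem mach_acc (r : ℕ) [NeZero r] (w : List Bool) :
    w ∈ lang (mach r) ↔ ∃ t, Trig r w t := by
  change Accepts _ _ ↔ _
  rw [accepts_iff]
  have hinit : initConf (mach r) w = mconf r w 0 := by
    simp [initConf, mconf, mach]
  have hr : 0 < r := Nat.pos_of_ne_zero (NeZero.ne r)
  rw [hinit]
  constructor
  · rintro ⟨c, h, h1, h2⟩
    by_contra hno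
    have : ∃ s, s ≤ w.length + 1 ∧ c = mconf r w s := by
      clear h1 h2
      induction h with
      | refl => exact ⟨0, by omega, rfl⟩
      | tail _ hst ih =>
        obtain ⟨s, hs, rfl⟩ := ih
        rcases mconf_step r w s hs _ hst with h | h
        · exact ⟨s + 1, by omega, h.2⟩
        · exact absurd h hno
    obtain ⟨s, hs, rfl⟩ := this
    rcases h2 with h2 | h2
    · exact Option.some_ne_none _ h2
    · exact Option.some_ne_none _ h2
  · rintro ⟨t, ht1, ht2, ht3⟩
    have key : ∀ s, s ≤ r * t → (∃ c, Relation.ReflTransGen (Step (mach r) w) (mconf r w 0) c ∧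
      Halted (mach r) w c ∧ AccConf (mach r) c) ∨
        Relation.ReflTransGen (Step (mach r) w) (mconf r w 0) (mconf r w s) := by
      intro s
      induction s with
      | zero => intro _; right; exact .refl
      | succ s ih =>
        intro hs
        rcases ih (by omega) with h | h
        · exact Or.inl h
        by_cases hc : ((s : ZMod r) = 0 ∧ tape w (s / r) = one ∧ tape w (w.length + 1 - s) = one)
        · left
          refine ⟨⟨(none : Option (ZMod r)), s / r, (none : Option (ZMod r)),
            w.length + 1 - s⟩, h.tail ?_, ?_, Or.inl rfl⟩
          · rw [mach_step]
            refine ⟨rfl, rfl, false, false, ?_, rfl, rfl⟩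
            exact jF_pos r _ _ _ hc
          · rintro ⟨c', hc'⟩
            rw [mach_step] at hc'
            obtain ⟨-, -, d1, d2, h, -⟩ := hc'
            simp [jF] at h
        · right
          refine h.tail ?_
          rw [mach_step]
          refine ⟨rfl, rfl, decide ((s : ZMod r) + 1 = 0), true, ?_, ?_, ?_⟩
          · refine (jF_neg r _ _ _ hc).trans ?_
            simp only [mconf]
            push_cast; rfl
          · simp only [mconf]
            rw [Nat.succ_div]
            have : ((s : ZMod r) + 1 = 0) ↔ r ∣ s + 1 := by
              rw [← ZMod.natCast_eq_zero_iff]; push_cast; rfl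
            by_cases hh : r ∣ s + 1
            · simp [hh, this]
            · simp [hh, this]
          · simp only [mconf, cond_true]
            omega
    rcases key (r * t) le_rfl with h | h
    · exact h
    · refine ⟨⟨(none : Option (ZMod r)), t, (none : Option (ZMod r)),
            w.length + 1 - r * t⟩, h.tail ?_, ?_, Or.inl rfl⟩
      · rw [mach_step]
        refine ⟨rfl, rfl, false, false, ?_, ?_, rfl⟩
        · refine jF_pos r _ _ _ ?_
          refine ⟨by simp, ?_, ht3⟩
          change tape w (r * t / r) = one
          rw [Nat.mul_div_cancel_left _ hr]; exact ht1
        · simp only [mconf]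
          rw [Nat.mul_div_cancel_left _ hr]; rfl
      · rintro ⟨c', hc'⟩
        rw [mach_step] at hc'
        obtain ⟨-, -, d1, d2, h, -⟩ := hc'
        simp [jF] at h

end WK

namespace WK

/-! ### Part 2: deterministic runs and the cut-and-paste argument -/

section runs

variable {α : Type} (A : DPWK α)

theorem step_det (w : List α) {c d d' : Config A} (h : Step A w c d) (h' : Step A w c d') :
    d = d' := by
  obtain ⟨p, i, q, j⟩ := d
  obtain ⟨p', i', q', j'⟩ := d'
  obtain ⟨a, b, h1, h2, h3, h4⟩ := h
  obtain ⟨a', b', h1', h2', h3', h4'⟩ := h'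
  simp only at *
  rw [h1] at h1'
  rw [h2] at h2'
  simp only [Option.some.injEq, Prod.mk.injEq] at h1' h2'
  obtain ⟨rfl, rfl⟩ := h1'
  obtain ⟨rfl, rfl⟩ := h2'
  have : j = j' := by omega
  subst h3 h3' this
  rfl

open Classical in
/-- Total successor function (halting configurations are fixed). -/
noncomputable def nx (w : List α) (c : Config A) : Config A :=
  if h : ∃ c', Step A w c c' then h.choose else c

theorem nx_of_step (w : List α) {c d : Config A} (h : Step A w c d) : nx A w c = d := by
  have h' : ∃ c', Step A w c c' := ⟨d, h⟩
  unfold nx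
  rw [dif_pos h']
  exact step_det A w h'.choose_spec h

theorem nx_of_halted (w : List α) {c : Config A} (h : Halted A w c) : nx A w c = c := by
  unfold nx
  exact dif_neg h

noncomputable def run (w : List α) (t : ℕ) : Config A := (nx A w)^[t] (initConf A w)

theorem run_succ (w : List α) (t : ℕ) : run A w (t + 1) = nx A w (run A w t) := by
  simp only [run, Function.iterate_succ_apply']

/-- accepting halting configuration -/
def Good (w : List α) (c : Config A) : Prop := Halted A w c ∧ AccConf A c

theorem accepts_iff_run (w : List α) : Accepts A w ↔ ∃ t, Good A w (run A w t) := by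
  rw [accepts_iff]
  constructor
  · rintro ⟨c, h, hg⟩
    have : ∃ t, c = run A w t := by
      clear hg
      induction h with
      | refl => exact ⟨0, rfl⟩
      | tail _ hst ih =>
        obtain ⟨t, rfl⟩ := ih
        exact ⟨t + 1, by rw [run_succ, nx_of_step A w hst]⟩
    obtain ⟨t, rfl⟩ := this
    exact ⟨t, hg⟩
  · rintro ⟨t, hg⟩
    refine ⟨_, ?_, hg⟩
    clear hg
    induction t with
    | zero => exact .refl
    | succ t ih =>
      rw [run_succ]
      by_cases h : ∃ c', Step A w (run A w t) c'
      · obtain ⟨d, hd⟩ := h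
        rw [nx_of_step A w hd]
        exact ih.tail hd
      · rw [nx_of_halted A w h]
        exact ih

theorem nx_mono (w : List α) (c : Config A) :
    c.i ≤ (nx A w c).i ∧ (nx A w c).i ≤ c.i + 1 ∧ (nx A w c).j ≤ c.j := by
  by_cases h : ∃ c', Step A w c c'
  · obtain ⟨d, hd⟩ := h
    rw [nx_of_step A w hd]
    obtain ⟨a, b, -, -, h3, h4⟩ := hd
    cases a <;> cases b <;> simp at h3 h4 <;> omega
  · rw [nx_of_halted A w h]
    omega

theorem run_mono (w : List α) {s t : ℕ} (h : s ≤ t) :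
    (run A w s).i ≤ (run A w t).i ∧ (run A w t).j ≤ (run A w s).j := by
  induction h with
  | refl => exact ⟨le_rfl, le_rfl⟩
  | @step m _ ih =>
    have := nx_mono A w (run A w m)
    rw [← run_succ] at this
    exact ⟨ih.1.trans this.1, this.2.2.trans ih.2⟩

theorem run_bound (w : List α) (t : ℕ) :
    (run A w t).i ≤ t ∧ (run A w t).j ≤ w.length + 1 := by
  induction t with
  | zero => exact ⟨le_rfl, le_rfl⟩
  | succ t ih =>
    have := nx_mono A w (run A w t)
    rw [← run_succ] at this
    omega

theorem step_congr (w w' : List α) (c d : Config A) (hi : tape w c.i = tape w' c.i)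
    (hj : tape w c.j = tape w' c.j) : Step A w c d ↔ Step A w' c d := by
  simp only [Step, hi, hj]

theorem halted_congr (w w' : List α) (c : Config A) (hi : tape w c.i = tape w' c.i)
    (hj : tape w c.j = tape w' c.j) : Halted A w c ↔ Halted A w' c := by
  unfold Halted
  simp only [step_congr A w w' c _ hi hj]

theorem nx_congr (w w' : List α) (c : Config A) (hi : tape w c.i = tape w' c.i)
    (hj : tape w c.j = tape w' c.j) : nx A w c = nx A w' c := by
  by_cases h : ∃ c', Step A w c c'
  · obtain ⟨d, hd⟩ := h
    rw [nx_of_step A w hd, nx_of_step A w' ((step_congr A w w' c d hi hj).1 hd)]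
  · rw [nx_of_halted A w h, nx_of_halted A w' ((halted_congr A w w' c hi hj).1 h)]

theorem tape_large (w : List α) (k : ℕ) (h : w.length + 1 ≤ k) : tape w k = Sum.inr true := by
  unfold tape
  by_cases hk : k = w.length + 1
  · subst hk
    simp [List.getD, List.getElem?_append]
  · rw [List.getD_eq_default]
    simp; omega

/-- Equality up to positions beyond the right end marker. -/
def Equi (w : List α) (c d : Config A) : Prop :=
  c.p = d.p ∧ c.q = d.q ∧ c.j = d.j ∧ min c.i (w.length + 1) = min d.i (w.length + 1)

theorem Equi.symm' {A : DPWK α} {w : List α} {c d : Config A} (h : Equi A w c d) :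
    Equi A w d c := ⟨h.1.symm, h.2.1.symm, h.2.2.1.symm, h.2.2.2.symm⟩

theorem Equi.tape_eq {A : DPWK α} {w : List α} {c d : Config A} (h : Equi A w c d) :
    tape w c.i = tape w d.i := by
  have h4 := h.2.2.2
  by_cases hc : c.i ≤ w.length
  · have : c.i = d.i := by omega
    rw [this]
  · rw [tape_large w c.i (by omega), tape_large w d.i (by omega)]

theorem equi_step {A : DPWK α} {w : List α} {c d c' : Config A} (h : Equi A w c d)
    (hs : Step A w c c') : ∃ d', Step A w d d' ∧ Equi A w c' d' := by
  have ht := h.tape_eq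
  obtain ⟨h1, h2, h3, h4⟩ := h
  obtain ⟨a, b, s1, s2, s3, s4⟩ := hs
  refine ⟨⟨c'.p, d.i + cond a 1 0, c'.q, c'.j⟩, ⟨a, b, ?_, ?_, rfl, ?_⟩, rfl, rfl, rfl, ?_⟩
  · rw [← h1, ← h2, ← h3, ← ht]; exact s1
  · rw [← h1, ← h2, ← h3, ← ht]; exact s2
  · rw [← h3]; exact s4
  · simp only [s3]; omega

theorem equi_halted {A : DPWK α} {w : List α} {c d : Config A} (h : Equi A w c d)
    (hs : Halted A w c) : Halted A w d := by
  rintro ⟨d', hd⟩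
  obtain ⟨c', hc, -⟩ := equi_step h.symm' hd
  exact hs ⟨c', hc⟩

theorem equi_good {A : DPWK α} {w : List α} {c d : Config A} (h : Equi A w c d)
    (hs : Good A w c) : Good A w d := by
  refine ⟨equi_halted h hs.1, ?_⟩
  have := hs.2
  unfold AccConf at *
  rwa [← h.1, ← h.2.1]

theorem equi_nx {A : DPWK α} {w : List α} {c d : Config A} (h : Equi A w c d) :
    Equi A w (nx A w c) (nx A w d) := by
  by_cases hc : ∃ c', Step A w c c'
  · obtain ⟨c', hc⟩ := hc
    obtain ⟨d', hd, he⟩ := equi_step h hc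
    rw [nx_of_step A w hc, nx_of_step A w hd]
    exact he
  · rw [nx_of_halted A w hc, nx_of_halted A w (equi_halted h hc)]
    exact h

theorem equi_run {A : DPWK α} {w : List α} {a b : ℕ} (h : Equi A w (run A w a) (run A w b))
    (s : ℕ) : Equi A w (run A w (a + s)) (run A w (b + s)) := by
  induction s with
  | zero => exact h
  | succ s ih =>
    rw [← add_assoc, ← add_assoc, run_succ, run_succ]
    exact equi_nx ih

/-- Time bound for inputs of length `n`. -/
def TB (A : DPWK α) (n : ℕ) : ℕ :=
  (@Fintype.card A.Q1 A.fQ1) * ((n + 2) * ((@Fintype.card A.Q2 A.fQ2) * (n + 2)))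

theorem time_bound {A : DPWK α} {w : List α} (h : Accepts A w) :
    ∃ t ≤ TB A w.length, Good A w (run A w t) := by
  classical
  letI := A.fQ1
  letI := A.fQ2
  rw [accepts_iff_run] at h
  refine ⟨Nat.find h, ?_, Nat.find_spec h⟩
  by_contra hlt
  push Not at hlt
  set t := Nat.find h with htdef
  let f : Fin t → A.Q1 × Fin (w.length + 2) × A.Q2 × Fin (w.length + 2) := fun s =>
    ((run A w s).p, ⟨min (run A w s).i (w.length + 1), by omega⟩, (run A w s).q,
      ⟨(run A w s).j, by have := run_bound A w s; omega⟩)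
  have hcard : Fintype.card (A.Q1 × Fin (w.length + 2) × A.Q2 × Fin (w.length + 2)) <
      Fintype.card (Fin t) := by
    simp only [Fintype.card_prod, Fintype.card_fin]
    exact hlt
  obtain ⟨a, b, hab, he⟩ := Fintype.exists_ne_map_eq_of_card_lt f hcard
  have main : ∀ a b : Fin t, a < b → f a = f b → False := by
    intro a b hab he
    simp only [f, Prod.mk.injEq, Fin.mk.injEq] at he
    have heq : Equi A w (run A w b) (run A w a) :=
      ⟨he.1.symm, he.2.2.1.symm, he.2.2.2.symm, he.2.1.symm⟩
    have h2 := equi_run heq (t - b)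
    have hb := b.2
    have hab' : (a : ℕ) < b := hab
    rw [show (b : ℕ) + (t - b) = t by omega] at h2
    have := equi_good h2 (Nat.find_spec h)
    exact Nat.find_min h (m := a + (t - b)) (by omega) this
  rcases lt_or_gt_of_ne hab with h1 | h1
  · exact main a b h1 he
  · exact main b a h1 he.symm

theorem card_filter_down (P : ℕ → Prop) [DecidablePred P] (hP : ∀ t, P (t + 1) → P t) (M t : ℕ)
    (ht : t < M) : P t ↔ t < ((Finset.range M).filter P).card := by
  have hP' : ∀ s t, s ≤ t → P t → P s := by
    intro s t hst
    induction hst with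
    | refl => exact id
    | step _ ih => exact fun h => ih (hP _ h)
  constructor
  · intro h
    have : Finset.range (t + 1) ⊆ (Finset.range M).filter P := by
      intro s hs
      simp only [Finset.mem_range, Finset.mem_filter] at *
      exact ⟨by omega, hP' s t (by omega) h⟩
    have := Finset.card_le_card this
    simp at this
    omega
  · intro h
    by_contra hn
    have : (Finset.range M).filter P ⊆ Finset.range t := by
      intro s hs
      simp only [Finset.mem_range, Finset.mem_filter] at *
      by_contra hst
      exact hn (hP' t s (by omega) hs.2)
    have := Finset.card_le_card this
    simp at this
    omega

/-- finite type of crossing records -/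
abbrev FT (A : DPWK α) (n : ℕ) : Type :=
  Fin (TB A n + 2) × A.Q1 × Fin (TB A n + 2) × A.Q2 × Fin (n + 2)

noncomputable def pt (A : DPWK α) (n : ℕ) (w : List α) (t : ℕ) : FT A n :=
  (Fin.ofNat _ t, (run A w t).p, Fin.ofNat _ (run A w t).i, (run A w t).q,
    Fin.ofNat _ (run A w t).j)

theorem pt_inj {A : DPWK α} {n : ℕ} {w w' : List α} (hw : w.length = n) (hw' : w'.length = n)
    {t t' : ℕ} (ht : t ≤ TB A n + 1) (ht' : t' ≤ TB A n + 1) (h : pt A n w t = pt A n w' t') :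
    t = t' ∧ run A w t = run A w' t' := by
  simp only [pt, Prod.mk.injEq, Fin.ext_iff, Fin.val_ofNat] at h
  obtain ⟨h1, h2, h3, h4, h5⟩ := h
  have b1 := run_bound A w t
  have b2 := run_bound A w' t'
  rw [Nat.mod_eq_of_lt (by omega), Nat.mod_eq_of_lt (by omega)] at h1 h3 h5
  refine ⟨h1, ?_⟩
  cases h : run A w t
  cases h' : run A w' t'
  rw [h, h'] at h2 h3 h4 h5
  simp only at h2 h3 h4 h5
  subst h2 h3 h4 h5
  rfl

noncomputable def tauU (A : DPWK α) (n : ℕ) (w : List α) (β : ℕ) : ℕ :=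
  ((Finset.range (TB A n + 1)).filter fun t => (run A w t).i < β).card

noncomputable def tauL (A : DPWK α) (n : ℕ) (w : List α) (β : ℕ) : ℕ :=
  ((Finset.range (TB A n + 1)).filter fun t => β ≤ (run A w t).j).card

theorem tauU_le (A : DPWK α) (n : ℕ) (w : List α) (β : ℕ) : tauU A n w β ≤ TB A n + 1 := by
  refine (Finset.card_filter_le _ _).trans ?_
  simp

theorem tauL_le (A : DPWK α) (n : ℕ) (w : List α) (β : ℕ) : tauL A n w β ≤ TB A n + 1 := by
  refine (Finset.card_filter_le _ _).trans ?_
  simp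

theorem tauU_spec (A : DPWK α) (n : ℕ) (w : List α) (β t : ℕ) (ht : t ≤ TB A n) :
    (run A w t).i < β ↔ t < tauU A n w β :=
  card_filter_down (fun t => (run A w t).i < β)
    (fun t h => (run_mono A w (Nat.le_succ t)).1.trans_lt h) _ t (by omega)

theorem tauL_spec (A : DPWK α) (n : ℕ) (w : List α) (β t : ℕ) (ht : t ≤ TB A n) :
    β ≤ (run A w t).j ↔ t < tauL A n w β :=
  card_filter_down (fun t => β ≤ (run A w t).j)
    (fun t h => h.trans (run_mono A w (Nat.le_succ t)).2) _ t (by omega)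

/-- crossing profile with respect to four thresholds -/
noncomputable def prof (A : DPWK α) (n : ℕ) (β : Fin 4 → ℕ) (w : List α) :
    Fin 4 → FT A n × FT A n :=
  fun k => (pt A n w (tauU A n w (β k)), pt A n w (tauL A n w (β k)))

/-- some head is in the interval `[lo, hi)` -/
def inB {A : DPWK α} (lo hi : ℕ) (c : Config A) : Prop :=
  (lo ≤ c.i ∧ c.i < hi) ∨ (lo ≤ c.j ∧ c.j < hi)

theorem mix {A : DPWK α} {n : ℕ} {w1 w2 w3 : List α} (hw1 : w1.length = n) (hw2 : w2.length = n)
    (hw3 : w3.length = n) (β : Fin 4 → ℕ)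
    (h31 : ∀ p, ¬ (β 2 ≤ p ∧ p < β 3) → tape w3 p = tape w1 p)
    (h32 : ∀ p, ¬ (β 0 ≤ p ∧ p < β 1) → tape w3 p = tape w2 p)
    (hun : ∀ t, ¬ (inB (β 0) (β 1) (run A w1 t) ∧ inB (β 2) (β 3) (run A w1 t)))
    (hp : prof A n β w1 = prof A n β w2) (hacc : Accepts A w3) :
    Accepts A w1 ∨ Accepts A w2 := by
  classical
  have hU : ∀ k, tauU A n w1 (β k) = tauU A n w2 (β k) ∧
      run A w1 (tauU A n w1 (β k)) = run A w2 (tauU A n w1 (β k)) := by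
    intro k
    have h := congrFun hp k
    simp only [prof, Prod.mk.injEq] at h
    have := pt_inj hw1 hw2 (tauU_le ..) (tauU_le ..) h.1
    exact ⟨this.1, by rw [this.2, ← this.1]⟩
  have hL : ∀ k, tauL A n w1 (β k) = tauL A n w2 (β k) ∧
      run A w1 (tauL A n w1 (β k)) = run A w2 (tauL A n w1 (β k)) := by
    intro k
    have h := congrFun hp k
    simp only [prof, Prod.mk.injEq] at h
    have := pt_inj hw1 hw2 (tauL_le ..) (tauL_le ..) h.2
    exact ⟨this.1, by rw [this.2, ← this.1]⟩
  have sU : ∀ t ≤ TB A n, ∀ k, (run A w1 t).i < β k ↔ (run A w2 t).i < β k := by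
    intro t ht k
    rw [tauU_spec A n w1 _ t ht, tauU_spec A n w2 _ t ht, (hU k).1]
  have sL : ∀ t ≤ TB A n, ∀ k, β k ≤ (run A w1 t).j ↔ β k ≤ (run A w2 t).j := by
    intro t ht k
    rw [tauL_spec A n w1 _ t ht, tauL_spec A n w2 _ t ht, (hL k).1]
  -- either nothing is crossed, or the configurations agree
  have ev : ∀ t, t + 1 ≤ TB A n → run A w1 (t + 1) = run A w2 (t + 1) ∨
      ∀ k, ((run A w1 (t + 1)).i < β k ↔ (run A w1 t).i < β k) ∧
        (β k ≤ (run A w1 (t + 1)).j ↔ β k ≤ (run A w1 t).j) := by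
    intro t ht
    by_contra hcon
    push Not at hcon
    obtain ⟨hne, k, hk⟩ := hcon
    have m := run_mono A w1 (Nat.le_succ t)
    by_cases hi : ((run A w1 (t + 1)).i < β k ↔ (run A w1 t).i < β k)
    · have hj := hk hi
      have e : tauL A n w1 (β k) = t + 1 := by
        have e1 := tauL_spec A n w1 (β k) t (by omega)
        have e2 := tauL_spec A n w1 (β k) (t + 1) ht
        simp only [Nat.succ_eq_add_one] at m
        omega
      have := (hL k).2
      rw [e] at this
      exact hne this
    · have e : tauU A n w1 (β k) = t + 1 := by
        have e1 := tauU_spec A n w1 (β k) t (by omega)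
        have e2 := tauU_spec A n w1 (β k) (t + 1) ht
        simp only [Nat.succ_eq_add_one] at m
        omega
      have := (hU k).2
      rw [e] at this
      exact hne this
  have inX : ∀ t ≤ TB A n, ∀ k l, inB (β k) (β l) (run A w1 t) ↔ inB (β k) (β l) (run A w2 t) := by
    intro t ht k l
    have := sU t ht k
    have := sU t ht l
    have := sL t ht k
    have := sL t ht l
    unfold inB
    omega
  have inv : ∀ t ≤ TB A n, (inB (β 0) (β 1) (run A w1 t) → run A w3 t = run A w1 t) ∧
      (¬ inB (β 0) (β 1) (run A w1 t) → run A w3 t = run A w2 t) ∧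
      (¬ inB (β 0) (β 1) (run A w1 t) → ¬ inB (β 2) (β 3) (run A w1 t) →
        run A w1 t = run A w2 t) := by
    intro t
    induction t with
    | zero =>
      intro _
      have e1 : run A w3 0 = run A w1 0 := by simp [run, initConf, hw1, hw3]
      have e2 : run A w3 0 = run A w2 0 := by simp [run, initConf, hw2, hw3]
      exact ⟨fun _ => e1, fun _ => e2, fun _ _ => e1.symm.trans e2⟩
    | succ t ih =>
      intro ht
      obtain ⟨ih1, ih2, ih3⟩ := ih (by omega)
      have st1 : inB (β 0) (β 1) (run A w1 t) → run A w3 (t + 1) = run A w1 (t + 1) := by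
        intro h
        rw [run_succ, run_succ, ih1 h]
        have hn : ¬ inB (β 2) (β 3) (run A w1 t) := fun h' => hun t ⟨h, h'⟩
        unfold inB at hn
        push Not at hn
        exact nx_congr A w3 w1 _ (h31 _ (by have := hn.1; omega)) (h31 _ (by have := hn.2; omega))
      have st2 : ¬ inB (β 0) (β 1) (run A w1 t) → run A w3 (t + 1) = run A w2 (t + 1) := by
        intro h
        rw [run_succ, run_succ, ih2 h]
        rw [inX t (by omega)] at h
        unfold inB at h
        push Not at h
        exact nx_congr A w3 w2 _ (h32 _ (by have := h.1; omega)) (h32 _ (by have := h.2; omega))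
      rcases ev t ht with he | he
      · have : run A w3 (t + 1) = run A w1 (t + 1) := by
          by_cases h : inB (β 0) (β 1) (run A w1 t)
          · exact st1 h
          · rw [st2 h, he]
        exact ⟨fun _ => this, fun _ => this.trans he, fun _ _ => he⟩
      · have hX : ∀ k l, inB (β k) (β l) (run A w1 (t + 1)) ↔ inB (β k) (β l) (run A w1 t) := by
          intro k l
          have := he k
          have := he l
          unfold inB
          omega
        rw [hX, hX]
        refine ⟨st1, st2, fun h h' => ?_⟩
        rw [run_succ, run_succ, ← ih3 h h']
        unfold inB at h h'
        push Not at h h'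
        apply nx_congr A w1 w2
        · rw [← h31 _ (by have := h'.1; omega), ← h32 _ (by have := h.1; omega)]
        · rw [← h31 _ (by have := h'.2; omega), ← h32 _ (by have := h.2; omega)]
  obtain ⟨t, ht, hg⟩ := time_bound hacc
  rw [hw3] at ht
  obtain ⟨i1, i2, -⟩ := inv t ht
  by_cases h : inB (β 0) (β 1) (run A w1 t)
  · left
    rw [accepts_iff_run]
    refine ⟨t, ?_⟩
    rw [i1 h] at hg
    have hn : ¬ inB (β 2) (β 3) (run A w1 t) := fun h' => hun t ⟨h, h'⟩
    unfold inB at hn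
    push Not at hn
    exact ⟨(halted_congr A w3 w1 _ (h31 _ (by have := hn.1; omega))
      (h31 _ (by have := hn.2; omega))).1 hg.1, hg.2⟩
  · right
    rw [accepts_iff_run]
    refine ⟨t, ?_⟩
    rw [i2 h] at hg
    rw [inX t ht] at h
    unfold inB at h
    push Not at h
    exact ⟨(halted_congr A w3 w2 _ (h32 _ (by have := h.1; omega))
      (h32 _ (by have := h.2; omega))).1 hg.1, hg.2⟩

end runs

end WK

namespace WK

/-! ### Part 3: the hard words and the counting -/

/-- The word of length `N - 1` whose tape position `p` (`1 ≤ p < N`) holds `f p`. -/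
def wd (N : ℕ) (f : ℕ → Bool) : List Bool := (List.range (N - 1)).map fun k => f (k + 1)

theorem wd_length (N : ℕ) (f : ℕ → Bool) : (wd N f).length = N - 1 := by simp [wd]

theorem tape_wd (N : ℕ) (hN : 1 ≤ N) (f : ℕ → Bool) (p : ℕ) :
    tape (wd N f) p = if p = 0 then Sum.inr false else if p < N then Sum.inl (f p)
      else Sum.inr true := by
  by_cases h0 : p = 0
  · subst h0; simp [tape]
  · rw [if_neg h0]
    by_cases hp : p < N
    · rw [if_pos hp]
      obtain ⟨k, rfl⟩ : ∃ k, p = k + 1 := ⟨p - 1, by omega⟩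
      have hk : k < N - 1 := by omega
      simp [tape, wd, List.getD, List.getElem?_append, hk]
    · rw [if_neg hp]
      exact tape_large _ _ (by rw [wd_length]; omega)

abbrev Dat (m : ℕ) : Type := Fin 3 → Fin m → Bool

def pos (m : ℕ) (r : Fin 3) (k : Fin m) : ℕ := (8 - r) * m + k

def OneP (m : ℕ) (X Y : Dat m) (q : ℕ) : Prop :=
  (∃ r k, q = pos m r k ∧ X r k = true) ∨
    (∃ (r : Fin 3) (k : Fin m), q + (r + 1) * pos m r k = 60 * m ∧ Y r k = false)

open Classical in
noncomputable def W (m : ℕ) (X Y : Dat m) : List Bool := wd (60 * m) fun q => decide (OneP m X Y q)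

theorem W_length (m : ℕ) (X Y : Dat m) : (W m X Y).length = 60 * m - 1 := wd_length _ _

theorem pos_range (m : ℕ) (r : Fin 3) (k : Fin m) : 6 * m ≤ pos m r k ∧ pos m r k < 9 * m := by
  have := k.2
  unfold pos
  fin_cases r <;> simp <;> omega

theorem tape_W_one (m : ℕ) (hm : 1 ≤ m) (X Y : Dat m) (p : ℕ) :
    tape (W m X Y) p = one ↔ p ≠ 0 ∧ p < 60 * m ∧ OneP m X Y p := by
  unfold W
  rw [tape_wd _ (by omega)]
  split_ifs <;> simp_all

theorem pos_inj (m : ℕ) (r : Fin 3) (k k' : Fin m) (h : pos m r k = pos m r k') : k = k' := by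
  unfold pos at h
  ext
  omega

/-- a matched word does not trigger any of the three machines -/
theorem no_trig (m : ℕ) (hm : 1 ≤ m) (X : Dat m) (r : ℕ) (hr : r = 1 ∨ r = 2 ∨ r = 3) (t : ℕ) :
    ¬ Trig r (W m X X) t := by
  rintro ⟨h1, h2, h3⟩
  rw [W_length] at h2 h3
  rw [show 60 * m - 1 + 1 = 60 * m by omega] at h2 h3
  rw [tape_W_one m hm] at h1 h3
  obtain ⟨-, -, h1⟩ := h1
  obtain ⟨-, -, h3⟩ := h3
  obtain ⟨u, hu⟩ : ∃ u, u = 60 * m - r * t := ⟨_, rfl⟩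
  rw [← hu] at h3
  have hu' : u + r * t = 60 * m := by omega
  rcases h1 with ⟨s, k, e1, x1⟩ | ⟨s, k, e1, x1⟩ <;> rcases h3 with ⟨s', k', e3, x3⟩ | ⟨s', k', e3, x3⟩
  · have := pos_range m s k
    have := pos_range m s' k'
    rcases hr with rfl | rfl | rfl <;> omega
  · have key : s = s' ∧ pos m s k = pos m s' k' := by
      have hk := k.2
      have hk' := k'.2
      unfold pos at *
      rcases hr with rfl | rfl | rfl <;> fin_cases s <;> fin_cases s' <;> simp at * <;> omega
    obtain ⟨rfl, h⟩ := key
    have := pos_inj m s k k' h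
    subst this
    simp_all
  · have key : s = s' ∧ pos m s k = pos m s' k' := by
      have hk := k.2
      have hk' := k'.2
      unfold pos at *
      rcases hr with rfl | rfl | rfl <;> fin_cases s <;> fin_cases s' <;> simp at * <;> omega
    obtain ⟨rfl, h⟩ := key
    have := pos_inj m s k k' h
    subst this
    simp_all
  · have a1 := pos_range m s k
    have a2 := pos_range m s' k'
    have b1 : (s + 1 : ℕ) * pos m s k ≤ 3 * pos m s k := Nat.mul_le_mul_right _ (by omega)
    have b2 : (s' + 1 : ℕ) * pos m s' k' ≤ 3 * pos m s' k' := Nat.mul_le_mul_right _ (by omega)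
    rcases hr with rfl | rfl | rfl <;> omega

/-- a mismatched word triggers the corresponding machine -/
theorem yes_trig (m : ℕ) (hm : 1 ≤ m) (X Y : Dat m) (r : Fin 3) (k : Fin m) (hX : X r k = true)
    (hY : Y r k = false) : Trig (r + 1) (W m X Y) (pos m r k) := by
  have a1 := pos_range m r k
  have b1 : (r + 1 : ℕ) * pos m r k ≤ 3 * pos m r k := Nat.mul_le_mul_right _ (by omega)
  have b2 : 1 * pos m r k ≤ (r + 1 : ℕ) * pos m r k := Nat.mul_le_mul_right _ (by omega)
  unfold Trig
  rw [W_length, show 60 * m - 1 + 1 = 60 * m by omega]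
  refine ⟨?_, by omega, ?_⟩
  · rw [tape_W_one m hm]
    exact ⟨by omega, by omega, Or.inl ⟨r, k, rfl, hX⟩⟩
  · rw [tape_W_one m hm]
    exact ⟨by omega, by omega, Or.inr ⟨r, k, by omega, hY⟩⟩

/-- interval thresholds of pair `r` -/
def thr (m : ℕ) (r : Fin 3) : Fin 4 → ℕ :=
  ![(8 - r) * m, (9 - r) * m, 60 * m - (r + 1) * ((9 - r) * m) + 1,
    60 * m - (r + 1) * ((8 - r) * m) + 1]

theorem W_left (m : ℕ) (hm : 1 ≤ m) (X X' : Dat m) (r : Fin 3)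
    (h : ∀ s, s ≠ r → X s = X' s) (p : ℕ) (hp : ¬ (thr m r 2 ≤ p ∧ p < thr m r 3)) :
    tape (W m X X') p = tape (W m X X) p := by
  have : OneP m X X' p ↔ OneP m X X p := by
    unfold OneP
    apply or_congr Iff.rfl
    refine exists_congr fun s => exists_congr fun k => and_congr_right fun e => ?_
    by_cases hs : s = r
    · exfalso
      subst hs
      apply hp
      have := k.2
      unfold thr
      unfold pos at e
      fin_cases s <;> simp at * <;> omega
    · rw [h s hs]
  unfold W
  rw [tape_wd _ (by omega), tape_wd _ (by omega)]
  beta_reduce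
  rw [decide_eq_decide.2 this]

theorem W_right (m : ℕ) (hm : 1 ≤ m) (X X' : Dat m) (r : Fin 3)
    (h : ∀ s, s ≠ r → X s = X' s) (p : ℕ) (hp : ¬ (thr m r 0 ≤ p ∧ p < thr m r 1)) :
    tape (W m X X') p = tape (W m X' X') p := by
  have : OneP m X X' p ↔ OneP m X' X' p := by
    unfold OneP
    refine or_congr ?_ Iff.rfl
    refine exists_congr fun s => exists_congr fun k => and_congr_right fun e => ?_
    by_cases hs : s = r
    · exfalso
      subst hs
      apply hp
      have := k.2
      unfold thr
      unfold pos at e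
      fin_cases s <;> simp at * <;> omega
    · rw [h s hs]
  unfold W
  rw [tape_wd _ (by omega), tape_wd _ (by omega)]
  beta_reduce
  rw [decide_eq_decide.2 this]

/-- In every run one of the three pairs is never visited simultaneously. -/
theorem unvisited {A : DPWK Bool} (w : List Bool) (m : ℕ) : ∃ r : Fin 3,
    ∀ t, ¬ (inB (thr m r 0) (thr m r 1) (run A w t) ∧
      inB (thr m r 2) (thr m r 3) (run A w t)) := by
  by_contra hcon
  push Not at hcon
  obtain ⟨t0, h0⟩ := hcon 0
  obtain ⟨t1, h1⟩ := hcon 1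
  obtain ⟨t2, h2⟩ := hcon 2
  have hmono : ∀ s t, ((run A w s).i ≤ (run A w t).i ∧ (run A w t).j ≤ (run A w s).j) ∨
      ((run A w t).i ≤ (run A w s).i ∧ (run A w s).j ≤ (run A w t).j) := by
    intro s t
    rcases le_total s t with h | h
    · exact Or.inl (run_mono A w h)
    · exact Or.inr (run_mono A w h)
  have m01 := hmono t0 t1
  have m02 := hmono t0 t2
  have m12 := hmono t1 t2
  generalize run A w t0 = c0 at *
  generalize run A w t1 = c1 at *
  generalize run A w t2 = c2 at *
  obtain ⟨p0, i0, q0, j0⟩ := c0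
  obtain ⟨p1, i1, q1, j1⟩ := c1
  obtain ⟨p2, i2, q2, j2⟩ := c2
  simp [inB, thr] at h0 h1 h2 m01 m02 m12
  have g0 : (8 * m ≤ i0 ∧ i0 < 9 * m ∧ 51 * m < j0 ∧ j0 ≤ 52 * m) ∨
    (8 * m ≤ j0 ∧ j0 < 9 * m ∧ 51 * m < i0 ∧ i0 ≤ 52 * m) := by omega
  have g1 : (7 * m ≤ i1 ∧ i1 < 8 * m ∧ 44 * m < j1 ∧ j1 ≤ 46 * m) ∨
    (7 * m ≤ j1 ∧ j1 < 8 * m ∧ 44 * m < i1 ∧ i1 ≤ 46 * m) := by omega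
  have g2 : (6 * m ≤ i2 ∧ i2 < 7 * m ∧ 39 * m < j2 ∧ j2 ≤ 42 * m) ∨
    (6 * m ≤ j2 ∧ j2 < 7 * m ∧ 39 * m < i2 ∧ i2 ≤ 42 * m) := by omega
  clear h0 h1 h2 hmono
  rcases g0 with g0 | g0 <;> rcases g1 with g1 | g1 <;> rcases g2 with g2 | g2 <;> omega

theorem exists_large (q1 q2 : ℕ) : ∃ m : ℕ, 1 ≤ m ∧ ∀ T n : ℕ, n = 60 * m - 1 →
    T = q1 * ((n + 2) * (q2 * (n + 2))) →
    3 * ((((T + 2) * (q1 * ((T + 2) * (q2 * (n + 2))))) *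
      ((T + 2) * (q1 * ((T + 2) * (q2 * (n + 2)))))) ^ 4) < 2 ^ m := by
  obtain ⟨K, hK⟩ : ∃ K, K = q1 * q2 * 61 ^ 2 + 2 := ⟨_, rfl⟩
  obtain ⟨E, hE⟩ : ∃ E, E = K * (q1 * (K * (q2 * 61))) := ⟨_, rfl⟩
  have hlim := tendsto_pow_const_div_const_pow_of_one_lt 40 (r := (2 : ℝ)) (by norm_num)
  have hpos : (0 : ℝ) < 1 / (3 * E ^ 8 + 1) := by positivity
  have ev := (hlim.eventually (gt_mem_nhds hpos)).and (Filter.eventually_ge_atTop 1)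
  obtain ⟨m, hm, hm1⟩ := ev.exists
  refine ⟨m, hm1, ?_⟩
  intro T n hn hT
  have hmain : 3 * E ^ 8 * m ^ 40 < 2 ^ m := by
    rw [div_lt_div_iff₀ (by positivity) (by positivity)] at hm
    have h2 : ((3 * E ^ 8 * m ^ 40 : ℕ) : ℝ) < ((2 ^ m : ℕ) : ℝ) := by
      push_cast
      have : (0 : ℝ) ≤ (m : ℝ) ^ 40 := by positivity
      nlinarith
    exact_mod_cast h2
  refine lt_of_le_of_lt ?_ hmain
  have hn2 : n + 2 ≤ 61 * m := by omega
  have hT2 : T + 2 ≤ K * m ^ 2 := by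
    rw [hT, hK]
    calc q1 * ((n + 2) * (q2 * (n + 2))) + 2 ≤ q1 * ((61 * m) * (q2 * (61 * m))) + 2 * m ^ 2 := by
          gcongr
          have := Nat.one_le_pow 2 m hm1
          omega
      _ = _ := by ring
  calc _ ≤ 3 * (((K * m ^ 2) * (q1 * ((K * m ^ 2) * (q2 * (61 * m))))) *
      ((K * m ^ 2) * (q1 * ((K * m ^ 2) * (q2 * (61 * m)))))) ^ 4 := by gcongr
    _ = _ := by rw [hE]; ring

theorem lower_bound (A : DPWK Bool)
    (hA : lang A = lang (mach 1) ∪ lang (mach 2) ∪ lang (mach 3)) : False := by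
  classical
  letI := A.fQ1
  letI := A.fQ2
  obtain ⟨m, hm, hbig⟩ := exists_large (Fintype.card A.Q1) (Fintype.card A.Q2)
  have hmem : ∀ w, Accepts A w ↔ ∃ r : Fin 3, ∃ t, Trig (r + 1) w t := by
    intro w
    change w ∈ lang A ↔ _
    rw [hA]
    simp only [Set.mem_union, mach_acc, Fin.exists_fin_succ]
    simp [or_assoc]
  have hrej : ∀ X, ¬ Accepts A (W m X X) := by
    intro X h
    rw [hmem] at h
    obtain ⟨r, t, h⟩ := h
    refine no_trig m hm X (r + 1) ?_ t h
    fin_cases r <;> simp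
  have hun : ∀ X : Dat m, ∃ r : Fin 3, ∀ t, ¬ (inB (thr m r 0) (thr m r 1) (run A (W m X X) t) ∧
      inB (thr m r 2) (thr m r 3) (run A (W m X X) t)) := fun X => unvisited _ m
  choose ρ hρ using hun
  let n := 60 * m - 1
  let f : Dat m → Fin 3 × (Fin 2 → Fin m → Bool) × (Fin 4 → FT A n × FT A n) := fun X =>
    (ρ X, (ρ X).removeNth X, prof A n (thr m (ρ X)) (W m X X))
  have hcard : Fintype.card (Fin 3 × (Fin 2 → Fin m → Bool) × (Fin 4 → FT A n × FT A n)) <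
      Fintype.card (Dat m) := by
    have h := hbig (TB A n) n rfl rfl
    simp only [Fintype.card_prod, Fintype.card_fin, Fintype.card_pi, Fintype.card_bool,
      Finset.prod_const, Finset.card_univ]
    have hp : 0 < (2 ^ m) ^ 2 := by positivity
    calc _ = (2 ^ m) ^ 2 * (3 * ((((TB A n + 2) * (Fintype.card A.Q1 * ((TB A n + 2) * (Fintype.card A.Q2 * (n + 2))))) *
      ((TB A n + 2) * (Fintype.card A.Q1 * ((TB A n + 2) * (Fintype.card A.Q2 * (n + 2)))))) ^ 4)) := by ring
      _ < (2 ^ m) ^ 2 * 2 ^ m := Nat.mul_lt_mul_of_pos_left h hp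
      _ = _ := by ring
  obtain ⟨X, X', hne, he⟩ := Fintype.exists_ne_map_eq_of_card_lt f hcard
  simp only [f, Prod.mk.injEq] at he
  obtain ⟨e1, e2, e3⟩ := he
  have hρ' := hρ X'
  have hρX := hρ X
  rw [← e1] at e2 e3 hρ'
  generalize ρ X = r at *
  have hoff : ∀ s, s ≠ r → X s = X' s := by
    intro s hs
    obtain ⟨z, rfl⟩ := Fin.exists_succAbove_eq hs
    exact congrFun e2 z
  have hr : X r ≠ X' r := by
    intro h
    apply hne
    funext s
    by_cases hs : s = r
    · rw [hs, h]
    · exact hoff s hs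
  obtain ⟨k, hk⟩ := Function.ne_iff.1 hr
  have main : ∀ X X' : Dat m, (∀ s, s ≠ r → X s = X' s) →
      (∀ t, ¬ (inB (thr m r 0) (thr m r 1) (run A (W m X X) t) ∧
        inB (thr m r 2) (thr m r 3) (run A (W m X X) t))) →
      prof A n (thr m r) (W m X X) = prof A n (thr m r) (W m X' X') →
      X r k = true → X' r k = false → False := by
    intro X X' hoff hu hp h1 h2
    have hacc : Accepts A (W m X X') := (hmem _).2 ⟨r, _, yes_trig m hm X X' r k h1 h2⟩
    rcases mix (W_length m X X) (W_length m X' X') (W_length m X X') (thr m r)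
      (W_left m hm X X' r hoff) (W_right m hm X X' r hoff) hu hp hacc with h | h
    · exact hrej _ h
    · exact hrej _ h
  cases hx : X r k <;> cases hx' : X' r k
  · exact hk (hx.trans hx'.symm)
  · exact main X' X (fun s hs => (hoff s hs).symm) hρ' e3.symm hx' hx
  · exact main X X' hoff hρX e3 hx hx'
  · exact hk (hx.trans hx'.symm)

end WK

open WK in
/-- The family of languages accepted by reversible deterministic
two-party Watson-Crick systems is not closed under union. -/
theorem REV_PWK_not_closed_union :
    ∃ (L1 L2 : Set (List Bool)), L1 ∈ RevPWKLangs Bool ∧ L2 ∈ RevPWKLangs Bool ∧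
      (L1 ∪ L2) ∉ RevPWKLangs Bool := by
  by_contra hcon
  push Not at hcon
  have h1 : lang (mach 1) ∈ RevPWKLangs Bool := ⟨_, mach_rev 1, rfl⟩
  have h2 : lang (mach 2) ∈ RevPWKLangs Bool := ⟨_, mach_rev 2, rfl⟩
  have h3 : lang (mach 3) ∈ RevPWKLangs Bool := ⟨_, mach_rev 3, rfl⟩
  obtain ⟨A, -, hA⟩ := hcon _ _ (hcon _ _ h1 h2) h3
  exact lower_bound A hA
end

section
/- Neither the language L·L nor L^* , where L = { a^n b^n : n ≥ 1 }, is accepted by any deterministic two-party Watson-Crick system (reversible or not); hence the family of REV-PWK languages is not closed under concatenation or iteration. -/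
/-- `L = { aⁿbⁿ : n ≥ 1 }` (with `a = false`, `b = true`). -/
def Lab : Set (List Bool) :=
  { w | ∃ n : ℕ, 1 ≤ n ∧ w = List.replicate n false ++ List.replicate n true }

/-- The concatenation `L·L`. -/
def LabLab : Set (List Bool) := { w | ∃ u ∈ Lab, ∃ v ∈ Lab, w = u ++ v }

/-- The iteration (Kleene star) `L^*`. -/
def LabStar : Set (List Bool) :=
  { w | ∃ ls : List (List Bool), (∀ u ∈ ls, u ∈ Lab) ∧ w = ls.flatten }

namespace TT
variable {S Sy : Type}

inductive Acc (T : S → Sy → Sy → Option (S × Bool × Bool)) (acc : S → Prop) :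
    S → List Sy → List Sy → Prop
  | halt {s x y U V} : T s x y = none → acc s → Acc T acc s (x :: U) (y :: V)
  | step {s x y U V s' d1 d2} : T s x y = some (s', d1, d2) →
      Acc T acc s' ((x :: U).drop (cond d1 1 0)) ((y :: V).drop (cond d2 1 0)) →
      Acc T acc s (x :: U) (y :: V)

/-- swapped machine -/
def swp (T : S → Sy → Sy → Option (S × Bool × Bool)) : S → Sy → Sy → Option (S × Bool × Bool) :=
  fun s x y => (T s y x).map fun z => (z.1, z.2.2, z.2.1)

theorem swp_swp (T : S → Sy → Sy → Option (S × Bool × Bool)) : swp (swp T) = T := by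
  funext s x y
  simp only [swp]
  cases T s x y <;> rfl

theorem Acc.swap {T : S → Sy → Sy → Option (S × Bool × Bool)} {acc : S → Prop} {s U V}
    (h : Acc T acc s U V) : Acc (swp T) acc s V U := by
  induction h with
  | halt h1 h2 => exact Acc.halt (by simp [swp, h1]) h2
  | step h1 _ ih => exact Acc.step (by simp [swp, h1]) ih

theorem Acc.swap_iff {T : S → Sy → Sy → Option (S × Bool × Bool)} {acc : S → Prop} {s U V} :
    Acc (swp T) acc s V U ↔ Acc T acc s U V :=
  ⟨fun h => by simpa [swp_swp] using h.swap, Acc.swap⟩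

section cell
variable (T : S → Sy → Sy → Option (S × Bool × Bool)) (x y : Sy)

def nx (s : S) : S := ((T s x y).map fun z => z.1).getD s
def mx (s : S) : ℕ := ((T s x y).map fun z => cond z.2.1 1 0).getD 0
def my (s : S) : ℕ := ((T s x y).map fun z => cond z.2.2 1 0).getD 0
def dx (s : S) (t : ℕ) : ℕ := ∑ i ∈ Finset.range t, mx T x y ((nx T x y)^[i] s)
def dy (s : S) (t : ℕ) : ℕ := ∑ i ∈ Finset.range t, my T x y ((nx T x y)^[i] s)

theorem nx_swp : nx (swp T) y x = nx T x y := by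
  funext s; simp only [nx, swp]; cases T s x y <;> rfl
theorem mx_swp : mx (swp T) y x = my T x y := by
  funext s; simp only [mx, my, swp]; cases T s x y <;> rfl
theorem my_swp : my (swp T) y x = mx T x y := by
  funext s; simp only [mx, my, swp]; cases T s x y <;> rfl
theorem dx_swp (s : S) : dx (swp T) y x s = dy T x y s := by
  funext t; simp only [dx, dy, mx_swp, nx_swp]
theorem dy_swp (s : S) : dy (swp T) y x s = dx T x y s := by
  funext t; simp only [dx, dy, my_swp, nx_swp]

theorem mx_le (s : S) : mx T x y s ≤ 1 := by
  simp only [mx]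
  rcases T s x y with _ | ⟨_, _ | _, _⟩ <;> simp
theorem my_le (s : S) : my T x y s ≤ 1 := by
  rw [← mx_swp]; exact mx_le _ _ _ _

theorem dx_succ (s : S) (t : ℕ) : dx T x y s (t+1) = dx T x y s t + mx T x y ((nx T x y)^[t] s) := by
  simp [dx, Finset.sum_range_succ]
theorem dy_succ (s : S) (t : ℕ) : dy T x y s (t+1) = dy T x y s t + my T x y ((nx T x y)^[t] s) := by
  simp [dy, Finset.sum_range_succ]

theorem dx_mono (s : S) : Monotone (dx T x y s) :=
  monotone_nat_of_le_succ fun t => by rw [dx_succ]; omega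
theorem dy_mono (s : S) : Monotone (dy T x y s) := by
  rw [← dx_swp]; exact dx_mono _ _ _ _
theorem dx_le (s : S) (t : ℕ) : dx T x y s t ≤ t := by
  induction t with
  | zero => simp [dx]
  | succ t ih => rw [dx_succ]; have := mx_le T x y ((nx T x y)^[t] s); omega
theorem dy_le (s : S) (t : ℕ) : dy T x y s t ≤ t := by
  rw [← dx_swp]; exact dx_le _ _ _ _ _

theorem acc_one (acc : S → Prop) (s : S) (r1 r2 : ℕ) (h1 : 1 ≤ r1) (h2 : 1 ≤ r2) (U V : List Sy) :
    Acc T acc s (List.replicate r1 x ++ U) (List.replicate r2 y ++ V) ↔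
    Acc T acc (nx T x y s) (List.replicate (r1 - mx T x y s) x ++ U)
      (List.replicate (r2 - my T x y s) y ++ V) := by
  obtain ⟨r1, rfl⟩ := Nat.exists_eq_add_of_le' h1
  obtain ⟨r2, rfl⟩ := Nat.exists_eq_add_of_le' h2
  rcases hT : T s x y with _ | ⟨s', d1, d2⟩
  · simp [nx, mx, my, hT]
  · simp only [nx, mx, my, hT, Option.map_some, Option.getD_some]
    have e1 : List.replicate (r1 + 1 - cond d1 1 0) x ++ U
        = (x :: (List.replicate r1 x ++ U)).drop (cond d1 1 0) := by
      cases d1 <;> simp [List.replicate_succ]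
    have e2 : List.replicate (r2 + 1 - cond d2 1 0) y ++ V
        = (y :: (List.replicate r2 y ++ V)).drop (cond d2 1 0) := by
      cases d2 <;> simp [List.replicate_succ]
    rw [e1, e2]
    simp only [List.replicate_succ, List.cons_append]
    constructor
    · intro h
      cases h with
      | halt h _ => simp [hT] at h
      | step h h' =>
        rw [hT] at h
        simp only [Option.some.injEq, Prod.mk.injEq] at h
        obtain ⟨rfl, rfl, rfl⟩ := h
        exact h'
    · intro h
      exact Acc.step hT h

theorem acc_run (acc : S → Prop) (s : S) (r1 r2 : ℕ) (U V : List Sy) (t : ℕ)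
    (h : ∀ τ < t, dx T x y s τ < r1 ∧ dy T x y s τ < r2) :
    Acc T acc s (List.replicate r1 x ++ U) (List.replicate r2 y ++ V) ↔
    Acc T acc ((nx T x y)^[t] s) (List.replicate (r1 - dx T x y s t) x ++ U)
      (List.replicate (r2 - dy T x y s t) y ++ V) := by
  induction t with
  | zero => simp [dx, dy]
  | succ t ih =>
    rw [ih fun τ hτ => h τ (by omega)]
    have := h t (by omega)
    rw [acc_one T x y acc _ _ _ (by omega) (by omega), Function.iterate_succ_apply', dx_succ, dy_succ,
      Nat.sub_sub, Nat.sub_sub]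

/-- acceptance without leaving the cell means halting in the cell -/
theorem acc_in_cell (acc : S → Prop) (s : S) (U V : List Sy)
    (ha : Acc T acc s U V) : ∀ (r1 r2 : ℕ) (U' V' : List Sy), U = List.replicate r1 x ++ U' →
      V = List.replicate r2 y ++ V' →
    (∀ τ, dx T x y s τ < r1 ∧ dy T x y s τ < r2) →
    ∃ t, T ((nx T x y)^[t] s) x y = none ∧ acc ((nx T x y)^[t] s) := by
  induction ha with
  | @halt s x' y' U V h1 h2 =>
    intro r1 r2 U' V' hU hV h
    have := h 0
    obtain ⟨r1, rfl⟩ := Nat.exists_eq_add_of_le' (show 1 ≤ r1 by omega)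
    obtain ⟨r2, rfl⟩ := Nat.exists_eq_add_of_le' (show 1 ≤ r2 by omega)
    simp only [List.replicate_succ, List.cons_append, List.cons.injEq] at hU hV
    obtain ⟨rfl, _⟩ := hU
    obtain ⟨rfl, _⟩ := hV
    exact ⟨0, h1, h2⟩
  | @step s x' y' U V s' d1 d2 hT _ ih =>
    intro r1 r2 U' V' hU hV h
    have := h 0
    obtain ⟨r1, rfl⟩ := Nat.exists_eq_add_of_le' (show 1 ≤ r1 by omega)
    obtain ⟨r2, rfl⟩ := Nat.exists_eq_add_of_le' (show 1 ≤ r2 by omega)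
    simp only [List.replicate_succ, List.cons_append, List.cons.injEq] at hU hV
    obtain ⟨rfl, rfl⟩ := hU
    obtain ⟨rfl, rfl⟩ := hV
    have hn : nx T x' y' s = s' := by simp [nx, hT]
    have e1 : mx T x' y' s = cond d1 1 0 := by simp [mx, hT]
    have e2 : my T x' y' s = cond d2 1 0 := by simp [my, hT]
    have hx : ∀ t, dx T x' y' s (t+1) = cond d1 1 0 + dx T x' y' s' t := by
      intro t; simp only [dx, Finset.sum_range_succ']
      simp [hn, e1, add_comm]
    have hy : ∀ t, dy T x' y' s (t+1) = cond d2 1 0 + dy T x' y' s' t := by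
      intro t; simp only [dy, Finset.sum_range_succ']
      simp [hn, e2, add_comm]
    obtain ⟨t, ht⟩ := ih (r1 + 1 - cond d1 1 0) (r2 + 1 - cond d2 1 0) U' V'
      (by cases d1 <;> simp [List.replicate_succ]) (by cases d2 <;> simp [List.replicate_succ])
      (fun τ => by have := h (τ+1); rw [hx, hy] at this; omega)
    exact ⟨t+1, by simpa [hn] using ht⟩

end cell

theorem iter_periodic [Fintype S] (h : S → S) (s : S) (t : ℕ) (ht : Fintype.card S ≤ t) :
    h^[t + (Fintype.card S).factorial] s = h^[t] s := by
  have : ∃ i j : Fin (Fintype.card S + 1), i ≠ j ∧ h^[i] s = h^[j] s :=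
    Fintype.exists_ne_map_eq_of_card_lt (fun i : Fin (Fintype.card S + 1) => h^[i] s) (by simp)
  have : ∃ i p : ℕ, 0 < p ∧ i + p ≤ Fintype.card S ∧ h^[i + p] s = h^[i] s := by
    obtain ⟨i, j, hij, he⟩ := this
    have hi := i.2
    have hj := j.2
    have hne : (i : ℕ) ≠ j := fun h => hij (Fin.ext h)
    rcases lt_or_gt_of_ne hne with h' | h'
    · exact ⟨i, j - i, by omega, by omega, by rw [Nat.add_sub_cancel' h'.le, he]⟩
    · exact ⟨j, i - j, by omega, by omega, by rw [Nat.add_sub_cancel' h'.le, he]⟩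
  obtain ⟨i, p, hp, hle, he⟩ := this
  have h1 : ∀ t, i ≤ t → h^[t + p] s = h^[t] s := by
    intro t ht
    obtain ⟨c, rfl⟩ := Nat.exists_eq_add_of_le' ht
    rw [show c + i + p = c + (i + p) by ring, Function.iterate_add_apply, he,
      ← Function.iterate_add_apply]
  have h2 : ∀ m t, i ≤ t → h^[t + m * p] s = h^[t] s := by
    intro m
    induction m with
    | zero => simp
    | succ m ih =>
      intro t ht
      rw [show t + (m+1) * p = (t + m * p) + p by ring, h1 _ (by omega), ih _ ht]
  obtain ⟨m, hm⟩ := Nat.dvd_factorial hp (show p ≤ Fintype.card S by omega)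
  rw [hm, mul_comm, h2 _ _ (by omega)]

section per
variable [Fintype S] (T : S → Sy → Sy → Option (S × Bool × Bool)) (x y : Sy)

abbrev NN (S : Type) [Fintype S] : ℕ := Fintype.card S
abbrev KK (S : Type) [Fintype S] : ℕ := (Fintype.card S).factorial

theorem dx_shift (s : S) (t m : ℕ) (ht : NN S ≤ t) :
    dx T x y s (t + m) + dx T x y s (t + KK S) = dx T x y s t + dx T x y s (t + m + KK S) := by
  induction m with
  | zero => simp
  | succ m ih =>
    rw [show t + (m+1) = (t+m)+1 by ring, show t + m + 1 + KK S = (t + m + KK S) + 1 by ring,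
      dx_succ, dx_succ, iter_periodic _ _ (t+m) (le_trans ht (Nat.le_add_right _ _))]
    omega

/-- displacement per period -/
def PX (s : S) : ℕ := dx T x y s (NN S + KK S) - dx T x y s (NN S)
def PY (s : S) : ℕ := dy T x y s (NN S + KK S) - dy T x y s (NN S)

theorem dx_per (s : S) (t : ℕ) (ht : NN S ≤ t) :
    dx T x y s (t + KK S) = dx T x y s t + PX T x y s := by
  obtain ⟨m, rfl⟩ := Nat.exists_eq_add_of_le ht
  have := dx_shift T x y s (NN S) m le_rfl
  have := dx_mono T x y s (show NN S ≤ NN S + KK S by omega)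
  simp only [PX]; omega

theorem PX_swp (s : S) : PX (swp T) y x s = PY T x y s := by simp only [PX, PY, dx_swp]
theorem PY_swp (s : S) : PY (swp T) y x s = PX T x y s := by simp only [PX, PY, dy_swp]

theorem dy_per (s : S) (t : ℕ) (ht : NN S ≤ t) :
    dy T x y s (t + KK S) = dy T x y s t + PY T x y s := by
  rw [← dx_swp, ← PX_swp]; exact dx_per _ _ _ _ _ ht

theorem PX_le (s : S) : PX T x y s ≤ KK S := by
  have : ∀ m, dx T x y s (NN S + m) ≤ dx T x y s (NN S) + m := by
    intro m
    induction m with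
    | zero => simp
    | succ m ih =>
      rw [← add_assoc, dx_succ]; have := mx_le T x y ((nx T x y)^[NN S + m] s); omega
  have := this (KK S)
  simp only [PX]; omega
theorem PY_le (s : S) : PY T x y s ≤ KK S := by rw [← PX_swp]; exact PX_le _ _ _ _

theorem per_mul (s : S) (m t : ℕ) (ht : NN S ≤ t) :
    (nx T x y)^[t + m * KK S] s = (nx T x y)^[t] s ∧
    dx T x y s (t + m * KK S) = dx T x y s t + m * PX T x y s ∧
    dy T x y s (t + m * KK S) = dy T x y s t + m * PY T x y s := by
  induction m with
  | zero => simp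
  | succ m ih =>
    obtain ⟨h1, h2, h3⟩ := ih
    rw [show t + (m+1) * KK S = (t + m * KK S) + KK S by ring]
    have : NN S ≤ t + m * KK S := by omega
    refine ⟨by rw [iter_periodic _ _ _ this, h1], ?_, ?_⟩
    · rw [dx_per _ _ _ _ _ this, h2]; ring
    · rw [dy_per _ _ _ _ _ this, h3]; ring

/-- integer version: shift by `κ` periods -/
theorem per_int (s : S) (κ : ℤ) (t t' : ℕ) (ht : NN S ≤ t) (ht' : NN S ≤ t')
    (h : (t' : ℤ) = t + κ * KK S) :
    (nx T x y)^[t'] s = (nx T x y)^[t] s ∧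
    (dx T x y s t' : ℤ) = dx T x y s t + κ * PX T x y s ∧
    (dy T x y s t' : ℤ) = dy T x y s t + κ * PY T x y s := by
  rcases le_total 0 κ with hk | hk
  · obtain ⟨m, rfl⟩ := Int.eq_ofNat_of_zero_le hk
    have : t' = t + m * KK S := by exact_mod_cast h
    subst this
    obtain ⟨h1, h2, h3⟩ := per_mul T x y s m t ht
    exact ⟨h1, by rw [h2]; push_cast; ring, by rw [h3]; push_cast; ring⟩
  · obtain ⟨m, hm⟩ := Int.eq_ofNat_of_zero_le (show 0 ≤ -κ by omega)
    obtain rfl : κ = -m := by omega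
    have : t = t' + m * KK S := by
      have : (t : ℤ) = t' + m * KK S := by rw [h]; ring
      exact_mod_cast this
    subst this
    obtain ⟨h1, h2, h3⟩ := per_mul T x y s m t' ht'
    exact ⟨h1.symm, by rw [h2]; push_cast; ring, by rw [h3]; push_cast; ring⟩

theorem dx_const (s : S) (h : PX T x y s = 0) (t : ℕ) (ht : NN S ≤ t) :
    dx T x y s t = dx T x y s (NN S) := by
  have h1 := dx_mono T x y s ht
  have h2 := (per_mul T x y s t (NN S) le_rfl).2.1
  have hk : 0 < KK S := Nat.factorial_pos _
  have h3 := dx_mono T x y s (show t ≤ NN S + t * KK S by nlinarith)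
  rw [h2, h, mul_zero] at h3
  omega

end per
section geom
variable [Fintype S] (T : S → Sy → Sy → Option (S × Bool × Bool)) (x y : Sy)

theorem ratio_bound (s : S) (t : ℕ) :
    |(PX T x y s : ℤ) * dy T x y s t - PY T x y s * dx T x y s t| ≤ KK S * (NN S + KK S) := by
  have hk : 0 < KK S := Nat.factorial_pos _
  induction t using Nat.strong_induction_on with
  | _ t ih =>
    by_cases h : t < NN S + KK S
    · have h1 := dx_le T x y s t
      have h2 := dy_le T x y s t
      have h3 := PX_le T x y s
      have h4 := PY_le T x y s
      have h5 : PX T x y s * dy T x y s t ≤ KK S * (NN S + KK S) := Nat.mul_le_mul h3 (by omega)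
      have h6 : PY T x y s * dx T x y s t ≤ KK S * (NN S + KK S) := Nat.mul_le_mul h4 (by omega)
      have h7 : (0:ℤ) ≤ (PX T x y s : ℤ) * dy T x y s t := by positivity
      have h8 : (0:ℤ) ≤ (PY T x y s : ℤ) * dx T x y s t := by positivity
      zify at h5 h6
      rw [abs_le]; constructor <;> linarith
    · obtain ⟨m, hm⟩ := Nat.exists_eq_add_of_le' (show KK S ≤ t by omega)
      have hm' : NN S ≤ m := by omega
      have := ih m (by omega)
      rw [hm, dx_per _ _ _ _ _ hm', dy_per _ _ _ _ _ hm']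
      push_cast
      convert this using 2
      ring

theorem exit_geom (acc : S → Prop) (s : S) (r1 r2 t E : ℕ)
    (hx : dx T x y s t = r1) (hy : dy T x y s t ≤ r2)
    (hlt : ∀ τ < t, dx T x y s τ < r1 ∧ dy T x y s τ < r2) :
    ∃ X Y : ℕ, 1 ≤ X ∧ X ≤ KK S ∧ Y ≤ KK S ∧
      |(X : ℤ) * dy T x y s t - Y * r1| ≤ KK S * (NN S + KK S) ∧
      ∀ κ e2 : ℤ, |κ| ≤ E → (κ = 0 ∨ NN S + 1 + KK S * E ≤ r1) →
        (e2 - Y * κ = 0 ∨ 1 ≤ ((r2 - dy T x y s t : ℕ) : ℤ) + (e2 - Y * κ)) →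
        ∀ U V : List Sy, Acc T acc ((nx T x y)^[t] s) U
          (List.replicate (((r2 - dy T x y s t : ℕ) : ℤ) + (e2 - Y * κ)).toNat y ++ V) →
        Acc T acc s (List.replicate ((r1 : ℤ) + X * κ).toNat x ++ U)
          (List.replicate ((r2 : ℤ) + e2).toNat y ++ V) := by
  have hk : 0 < KK S := Nat.factorial_pos _
  have zero : ∀ e2 : ℤ, (e2 = 0 ∨ 1 ≤ ((r2 - dy T x y s t : ℕ) : ℤ) + e2) →
      ∀ U V : List Sy, Acc T acc ((nx T x y)^[t] s) U
          (List.replicate (((r2 - dy T x y s t : ℕ) : ℤ) + e2).toNat y ++ V) →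
        Acc T acc s (List.replicate r1 x ++ U)
          (List.replicate ((r2 : ℤ) + e2).toNat y ++ V) := by
    intro e2 he U V h
    rw [acc_run T x y acc s _ _ _ _ t]
    · rw [hx, Nat.sub_self]
      have : ((r2 : ℤ) + e2).toNat - dy T x y s t = (((r2 - dy T x y s t : ℕ) : ℤ) + e2).toNat := by
        omega
      rw [this]; simpa using h
    · intro τ hτ
      have h1 := hlt τ hτ
      have h2 := dy_mono T x y s hτ.le
      refine ⟨h1.1, ?_⟩
      rcases he with rfl | he <;> omega
  by_cases hX : PX T x y s = 0
  · have htN : t ≤ NN S := by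
      by_contra hcon
      have h1 := dx_const T x y s hX t (by omega)
      have h2 := dx_const T x y s hX (t-1) (by omega)
      have h3 := hlt (t-1) (by omega)
      omega
    refine ⟨1, 0, le_rfl, hk, Nat.zero_le _, ?_, ?_⟩
    · have := dy_le T x y s t
      have h0 : dy T x y s t ≤ KK S * (NN S + KK S) := by nlinarith
      zify at h0
      simp only [Nat.cast_one, one_mul, Nat.cast_zero, zero_mul, sub_zero]
      rw [abs_of_nonneg (by positivity)]
      exact h0
    · intro κ e2 hκ hor he U V h
      have hκ0 : κ = 0 := by
        rcases hor with h | h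
        · exact h
        · exfalso
          have := dx_le T x y s t
          have : 0 ≤ KK S * E := Nat.zero_le _
          omega
      subst hκ0
      simp only [mul_zero, sub_zero, add_zero, Int.toNat_natCast] at he h ⊢
      exact zero e2 he U V h
  · refine ⟨PX T x y s, PY T x y s, by omega, PX_le _ _ _ _, PY_le _ _ _ _, ?_, ?_⟩
    · rw [← hx]; exact ratio_bound T x y s t
    · intro κ e2 hκ hor he U V h
      by_cases hκ0 : κ = 0
      · subst hκ0
        simp only [mul_zero, sub_zero, add_zero, Int.toNat_natCast] at he h ⊢
        exact zero e2 he U V h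
      · have hr : NN S + 1 + KK S * E ≤ r1 := by tauto
        have htr := dx_le T x y s t
        have hb : -((KK S * E : ℕ) : ℤ) ≤ κ * KK S := by
          push_cast
          have : -(E:ℤ) ≤ κ := by rw [abs_le] at hκ; exact hκ.1
          nlinarith
        obtain ⟨t', ht'⟩ := Int.eq_ofNat_of_zero_le (show 0 ≤ (t : ℤ) + κ * KK S by omega)
        have ht'N : NN S + 1 ≤ t' := by omega
        obtain ⟨p1, p2, p3⟩ := per_int T x y s κ t t' (by omega) (by omega) (by omega)
        obtain ⟨q1, q2, q3⟩ := per_int T x y s κ (t-1) (t'-1) (by omega) (by omega) (by omega)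
        have hl := hlt (t-1) (by omega)
        have c1 : κ * (PX T x y s : ℤ) = PX T x y s * κ := mul_comm _ _
        have c2 : κ * (PY T x y s : ℤ) = PY T x y s * κ := mul_comm _ _
        rw [c1] at p2 q2
        rw [c2] at p3 q3
        generalize (PX T x y s : ℤ) * κ = a at *
        generalize (PY T x y s : ℤ) * κ = b at *
        rw [acc_run T x y acc s _ _ _ _ t']
        · have e1 : ((r1 : ℤ) + a).toNat - dx T x y s t' = 0 := by omega
          have e2 : ((r2 : ℤ) + e2).toNat - dy T x y s t'
            = (((r2 - dy T x y s t : ℕ) : ℤ) + (e2 - b)).toNat := by omega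
          rw [e1, e2, p1]; simpa using h
        · intro τ hτ
          have h1 := dx_mono T x y s (show τ ≤ t' - 1 by omega)
          have h2 := dy_mono T x y s (show τ ≤ t' - 1 by omega)
          have h3 := dy_mono T x y s (show t' - 1 ≤ t' by omega)
          constructor
          · omega
          · rcases he with he | he <;> omega
end geom

def tp (U : List (Sy × ℕ)) : List Sy := U.flatMap fun b => List.replicate b.2 b.1
def pert (U : List (Sy × ℕ)) (u : List ℤ) : List (Sy × ℕ) :=
  List.zipWith (fun b e => (b.1, ((b.2 : ℤ) + e).toNat)) U u
def lens (U : List (Sy × ℕ)) : List ℤ := U.map fun b => (b.2 : ℤ)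
def term (t : ℕ) (c : ℕ × ℕ) (e : ℤ) : ℤ := if c.2 = t then c.1 * e else 0
def dot (t : ℕ) : List (ℕ × ℕ) → List ℤ → ℤ
  | c :: cs, e :: es => term t c e + dot t cs es
  | _, _ => 0
def Val (D E B : ℕ) (U : List (Sy × ℕ)) (u : List ℤ) : Prop :=
  List.Forall₂ (fun b e => (D : ℤ) ∣ e ∧ |e| ≤ E ∧ (e = 0 ∨ B ≤ b.2)) U u
def Coef (A : ℕ) (c : List (ℕ × ℕ)) : Prop :=
  (∀ p ∈ c, p.1 ≤ A) ∧ c.Pairwise (fun p q => p.2 ≤ q.2) ∧ ∀ p ∈ c.head?, p.2 = 0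

def Concl (T : S → Sy → Sy → Option (S × Bool × Bool)) (acc : S → Prop) (D A E B C : ℕ) (s : S)
    (U V : List (Sy × ℕ)) : Prop :=
  ∃ cu cv : List (ℕ × ℕ), cu.length = U.length ∧ cv.length = V.length ∧ Coef A cu ∧ Coef A cv ∧
    (∀ t, |dot t cu (lens U) - dot t cv (lens V)| ≤ C) ∧
    ∀ u v, Val D E B U u → Val D E B V v → (∀ t, dot t cu u = dot t cv v) →
      Acc T acc s (tp (pert U u)) (tp (pert V v))

theorem Concl.swap {T : S → Sy → Sy → Option (S × Bool × Bool)} {acc : S → Prop} {D A E B C : ℕ}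
    {s : S} {U V : List (Sy × ℕ)} (h : Concl T acc D A E B C s U V) :
    Concl (swp T) acc D A E B C s V U := by
  obtain ⟨cu, cv, h1, h2, h3, h4, h5, h6⟩ := h
  exact ⟨cv, cu, h2, h1, h4, h3, fun t => by rw [abs_sub_comm]; exact h5 t,
    fun u v hu hv he => (h6 v u hv hu fun t => (he t).symm).swap⟩

theorem Val.mono {D E B D' E' B' : ℕ} {U : List (Sy × ℕ)} {u : List ℤ} (h : Val D E B U u)
    (hD : D' ∣ D) (hE : E ≤ E') (hB : B' ≤ B) : Val D' E' B' U u := by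
  refine List.Forall₂.imp ?_ h
  intro b e ⟨h1, h2, h3⟩
  refine ⟨(Int.natCast_dvd_natCast.2 hD).trans h1, h2.trans (by exact_mod_cast hE), ?_⟩
  rcases h3 with h3 | h3
  · exact Or.inl h3
  · exact Or.inr (hB.trans h3)

/-- scale coefficients -/
def scl (X : ℕ) (c : List (ℕ × ℕ)) : List (ℕ × ℕ) := c.map fun p => (X * p.1, p.2)
/-- shift labels -/
def shf (c : List (ℕ × ℕ)) : List (ℕ × ℕ) := c.map fun p => (p.1, p.2 + 1)

theorem dot_scl (X t : ℕ) (c : List (ℕ × ℕ)) (u : List ℤ) : dot t (scl X c) u = X * dot t c u := by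
  induction c generalizing u with
  | nil => simp [scl, dot]
  | cons p c ih =>
    cases u with
    | nil => simp [scl, dot]
    | cons e u =>
      have := ih u
      simp only [scl, List.map_cons, dot, term] at this ⊢
      rw [this]; split_ifs <;> push_cast <;> ring

theorem dot_shf (t : ℕ) (c : List (ℕ × ℕ)) (u : List ℤ) : dot (t+1) (shf c) u = dot t c u := by
  induction c generalizing u with
  | nil => simp [shf, dot]
  | cons p c ih =>
    cases u with
    | nil => simp [shf, dot]
    | cons e u =>
      have := ih u
      simp only [shf, List.map_cons, dot, term] at this ⊢
      rw [this]; simp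

theorem dot_shf_zero (c : List (ℕ × ℕ)) (u : List ℤ) : dot 0 (shf c) u = 0 := by
  induction c generalizing u with
  | nil => simp [shf, dot]
  | cons p c ih =>
    cases u with
    | nil => simp [shf, dot]
    | cons e u =>
      have := ih u
      simp only [shf, List.map_cons, dot, term] at this ⊢
      rw [this]; simp

theorem dot_zero (t : ℕ) (n : ℕ) (u : List ℤ) : dot t (List.replicate n (0,0)) u = 0 := by
  induction n generalizing u with
  | zero => simp [dot]
  | succ n ih =>
    cases u with
    | nil => simp [List.replicate_succ, dot]
    | cons e u => simp [List.replicate_succ, dot, term, ih]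

theorem coef_zero (A n : ℕ) : Coef A (List.replicate n (0,0)) := by
  refine ⟨?_, ?_, ?_⟩
  · intro p hp; rw [List.eq_of_mem_replicate hp]; simp
  · rw [List.pairwise_replicate]; simp
  · intro p hp; rw [List.eq_of_mem_replicate (List.mem_of_mem_head? hp)]

theorem coef_cons {A : ℕ} {c : List (ℕ × ℕ)} {a : ℕ} (ha : a ≤ A) (h1 : ∀ p ∈ c, p.1 ≤ A)
    (h2 : c.Pairwise fun p q => p.2 ≤ q.2) : Coef A ((a, 0) :: c) := by
  refine ⟨?_, ?_, ?_⟩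
  · simpa [ha] using h1
  · simpa using h2
  · simp

theorem scl_le {A X K : ℕ} {c : List (ℕ × ℕ)} (hX : X ≤ K) (h : ∀ p ∈ c, p.1 ≤ A) :
    ∀ p ∈ scl X c, p.1 ≤ K * A := by
  intro p hp
  simp only [scl, List.mem_map] at hp
  obtain ⟨q, hq, rfl⟩ := hp
  exact Nat.mul_le_mul hX (h q hq)

theorem scl_pw {X : ℕ} {c : List (ℕ × ℕ)} (h : c.Pairwise fun p q => p.2 ≤ q.2) :
    (scl X c).Pairwise fun p q => p.2 ≤ q.2 := by
  rw [scl, List.pairwise_map]; exact h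

theorem shf_le {A : ℕ} {c : List (ℕ × ℕ)} (h : ∀ p ∈ c, p.1 ≤ A) :
    ∀ p ∈ shf c, p.1 ≤ A := by
  intro p hp
  simp only [shf, List.mem_map] at hp
  obtain ⟨q, hq, rfl⟩ := hp
  exact h q hq

theorem shf_pw {c : List (ℕ × ℕ)} (h : c.Pairwise fun p q => p.2 ≤ q.2) :
    (shf c).Pairwise fun p q => p.2 ≤ q.2 := by
  rw [shf, List.pairwise_map]; simpa using h


theorem tp_pert_cons (b : Sy × ℕ) (U : List (Sy × ℕ)) (e : ℤ) (u : List ℤ) :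
    tp (pert (b :: U) (e :: u)) = List.replicate ((b.2 : ℤ) + e).toNat b.1 ++ tp (pert U u) := by
  simp [tp, pert]

theorem abs_le_of (a b c d e : ℤ) (B1 B2 : ℤ) (h1 : |a| ≤ B1) (h2 : |b| ≤ B2)
    (h : e = c * a + d * b) (c' d' : ℤ) (hc : |c| ≤ c') (hd : |d| ≤ d') :
    |e| ≤ c' * B1 + d' * B2 := by
  rw [h]
  refine (abs_add_le _ _).trans (add_le_add ?_ ?_)
  · rw [abs_mul]; exact mul_le_mul hc h1 (abs_nonneg _) ((abs_nonneg _).trans hc)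
  · rw [abs_mul]; exact mul_le_mul hd h2 (abs_nonneg _) ((abs_nonneg _).trans hd)

theorem acc_nil_right {T : S → Sy → Sy → Option (S × Bool × Bool)} {acc : S → Prop} {s : S}
    {U : List Sy} : ¬ Acc T acc s U [] := by
  intro h
  generalize hW : ([] : List Sy) = W at h
  cases h <;> cases hW

section main
variable [Fintype S]

def bet (S : Type) [Fintype S] (E B : ℕ) : ℕ := B + E * (1 + KK S) + 1
def cst (S : Type) [Fintype S] (A E B C : ℕ) : ℕ :=
  KK S * C + A * (KK S * (NN S + KK S)) + C + A * bet S E B + KK S * bet S E B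
    + KK S * (NN S + KK S)

theorem exit_concl (T : S → Sy → Sy → Option (S × Bool × Bool)) (acc : S → Prop) (x y : Sy)
    (D A E B C : ℕ) (s : S) (r1 r2 t : ℕ) (U V : List (Sy × ℕ))
    (hx : dx T x y s t = r1) (hy : dy T x y s t ≤ r2)
    (hlt : ∀ τ < t, dx T x y s τ < r1 ∧ dy T x y s τ < r2)
    (IH : Concl T acc D A (E * (1 + KK S)) B C ((nx T x y)^[t] s) U ((y, r2 - dy T x y s t) :: V)) :
    Concl T acc (D * (KK S).factorial) (KK S * A + KK S) E (B + (NN S + 1 + KK S * E))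
      (cst S A E B C) s ((x, r1) :: U) ((y, r2) :: V) := by
  obtain ⟨X, Y, hX1, hXK, hYK, hrat, geom⟩ := exit_geom T x y acc s r1 r2 t E hx hy hlt
  obtain ⟨cu, cv, hlu, hlv, hcu, hcv, hbd, hacc⟩ := IH
  obtain ⟨⟨b0, l⟩, cv, rfl⟩ : ∃ c cv', cv = c :: cv' := by
    cases cv with
    | nil => simp at hlv
    | cons c cv => exact ⟨_, _, rfl⟩
  have hl : l = 0 := hcv.2.2 (b0, l) (by simp)
  subst hl
  have hb0 : b0 ≤ A := hcv.1 (b0, 0) (by simp)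
  have hcv1 : ∀ p ∈ cv, p.1 ≤ A := fun p hp => hcv.1 p (by simp [hp])
  have hcv2 : cv.Pairwise fun p q => p.2 ≤ q.2 := (List.pairwise_cons.1 hcv.2.1).2
  set ρ : ℕ := r2 - dy T x y s t with hρ
  have hr2 : r2 = ρ + dy T x y s t := by omega
  obtain ⟨q, hq⟩ := Nat.dvd_factorial (show 0 < X by omega) hXK
  -- unpacking of a valid perturbation
  have unpack : ∀ u v, Val (D * (KK S).factorial) E (B + (NN S + 1 + KK S * E)) ((x, r1) :: U) u →
      Val (D * (KK S).factorial) E (B + (NN S + 1 + KK S * E)) ((y, r2) :: V) v →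
      ∃ (κ e2 : ℤ) (u' v' : List ℤ), u = ((X : ℤ) * κ) :: u' ∧ v = e2 :: v' ∧ |κ| ≤ E ∧
        (κ = 0 ∨ NN S + 1 + KK S * E ≤ r1) ∧ Val D (E * (1 + KK S)) B U u' ∧
        Val D (E * (1 + KK S)) B V v' ∧ (D : ℤ) ∣ e2 - Y * κ ∧
        |e2 - Y * κ| ≤ (E * (1 + KK S) : ℕ) := by
    intro u v hu hv
    have hEE : E ≤ E * (1 + KK S) := Nat.le_mul_of_pos_right _ (by omega)
    obtain ⟨e1, u', ⟨he1, he1', he1''⟩, hu', rfl⟩ := List.forall₂_cons_left_iff.1 hu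
    obtain ⟨e2, v', ⟨he2, he2', he2''⟩, hv', rfl⟩ := List.forall₂_cons_left_iff.1 hv
    obtain ⟨ε, hε⟩ := he1
    have hXz : (X : ℤ) ≠ 0 := by positivity
    have hk : e1 = X * (D * q * ε) := by rw [hε, hq]; push_cast; ring
    have hκE : |(D * q * ε : ℤ)| ≤ E := by
      refine le_trans ?_ he1'
      have hk' : |e1| = |(X : ℤ)| * |(D * q * ε : ℤ)| := by rw [hk, abs_mul]
      rw [hk']
      refine le_mul_of_one_le_left (abs_nonneg _) ?_
      rw [Nat.abs_cast]; exact_mod_cast hX1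
    refine ⟨D * q * ε, e2, u', v', by rw [hk], rfl, hκE, ?_,
      Val.mono hu' (Dvd.intro _ rfl) hEE (by omega), Val.mono hv' (Dvd.intro _ rfl) hEE (by omega),
      ?_, ?_⟩
    · rcases he1'' with h | h
      · left
        rw [hk] at h
        rcases mul_eq_zero.1 h with h | h
        · exact absurd h hXz
        · exact h
      · right; simp only at h; omega
    · refine dvd_sub ?_ ⟨Y * (q * ε), by ring⟩
      exact (Int.natCast_dvd_natCast.2 (Dvd.intro _ rfl)).trans he2
    · refine (abs_sub _ _).trans ?_
      rw [abs_mul, Nat.abs_cast]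
      have : (Y : ℤ) * |(D * q * ε : ℤ)| ≤ KK S * E :=
        mul_le_mul (by exact_mod_cast hYK) hκE (abs_nonneg _) (by positivity)
      push_cast
      push_cast at this
      linarith
  have hXabs : |(X : ℤ)| ≤ KK S := by rw [Nat.abs_cast]; exact_mod_cast hXK
  have hb0abs : |(b0 : ℤ)| ≤ A := by rw [Nat.abs_cast]; exact_mod_cast hb0
  by_cases hcase : bet S E B ≤ ρ
  · -- no coincidence
    refine ⟨(Y * b0, 0) :: scl X cu, (X * b0, 0) :: scl X cv, ?_, ?_, ?_, ?_, ?_, ?_⟩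
    · simp [scl, hlu]
    · simpa [scl] using hlv
    · refine coef_cons ?_ (fun p hp => (scl_le hXK hcu.1 p hp).trans (by omega)) (scl_pw hcu.2.1)
      exact (Nat.mul_le_mul hYK hb0).trans (by omega)
    · refine coef_cons ?_ (fun p hp => (scl_le hXK hcv1 p hp).trans (by omega)) (scl_pw hcv2)
      exact (Nat.mul_le_mul hXK hb0).trans (by omega)
    · intro τ
      have h1 := hbd τ
      simp only [lens, List.map_cons, dot, dot_scl, term] at h1 ⊢
      by_cases hτ : (0 : ℕ) = τ
      · simp only [hτ, if_true] at h1 ⊢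
        refine (abs_le_of _ _ X (-b0) _ _ _ h1 hrat ?_ (KK S) A hXabs (by rw [abs_neg]; exact hb0abs)).trans ?_
        · rw [hr2]; push_cast; ring
        · simp only [cst]; push_cast; nlinarith [Nat.zero_le (A * bet S E B), Nat.zero_le (KK S * bet S E B), Nat.zero_le (KK S * (NN S + KK S))]
      · simp only [hτ, if_false, zero_add] at h1 ⊢
        rw [← mul_sub, abs_mul]
        refine (mul_le_mul hXabs h1 (abs_nonneg _) (by positivity)).trans ?_
        have : KK S * C ≤ cst S A E B C := by simp only [cst]; omega
        exact_mod_cast this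
    · intro u v hu hv hdot
      obtain ⟨κ, e2, u', v', rfl, rfl, hκE, hκ, hu', hv', hdv, hab⟩ := unpack u v hu hv
      rw [tp_pert_cons, tp_pert_cons]
      have hpos : 1 ≤ (ρ : ℤ) + (e2 - Y * κ) := by
        have := (abs_le.1 hab).1
        have h2 : ((B + E * (1 + KK S) + 1 : ℕ) : ℤ) ≤ ρ := by exact_mod_cast hcase
        push_cast at this h2 ⊢
        linarith
      refine geom κ e2 hκE hκ (Or.inr hpos) _ _ ?_
      have := hacc u' ((e2 - Y * κ) :: v') hu'
        (List.Forall₂.cons ⟨hdv, hab, Or.inr (by simp only [bet] at hcase; simp only; omega)⟩ hv') ?_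
      · rwa [tp_pert_cons] at this
      · intro τ
        have h1 := hdot τ
        have hXz : (X : ℤ) ≠ 0 := by positivity
        simp only [dot, dot_scl, term] at h1 ⊢
        apply mul_left_cancel₀ hXz
        by_cases hτ : (0 : ℕ) = τ
        · simp only [hτ, if_true] at h1 ⊢
          push_cast at h1
          linarith
        · simp only [hτ, if_false, zero_add] at h1 ⊢
          exact h1
  · -- coincidence
    have hρb : (ρ : ℤ) ≤ bet S E B := by exact_mod_cast (not_le.1 hcase).le
    have hρa : |(ρ : ℤ)| ≤ bet S E B := by rw [Nat.abs_cast]; exact hρb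
    refine ⟨(Y, 0) :: shf cu, (X, 0) :: shf cv, ?_, ?_, ?_, ?_, ?_, ?_⟩
    · simp [shf, hlu]
    · simpa [shf] using hlv
    · exact coef_cons (by omega) (fun p hp => (shf_le hcu.1 p hp).trans (by
        have : 1 * A ≤ KK S * A := Nat.mul_le_mul_right _ (Nat.factorial_pos _)
        omega)) (shf_pw hcu.2.1)
    · exact coef_cons (by omega) (fun p hp => (shf_le hcv1 p hp).trans (by
        have : 1 * A ≤ KK S * A := Nat.mul_le_mul_right _ (Nat.factorial_pos _)
        omega)) (shf_pw hcv2)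
    · intro τ
      cases τ with
      | zero =>
        simp only [lens, List.map_cons, dot, dot_shf_zero, term, if_true, add_zero]
        refine (abs_le_of _ _ (-X) (-1) _ _ _ hρa hrat ?_ (KK S) 1 (by rw [abs_neg]; exact hXabs) (by simp)).trans ?_
        · rw [hr2]; push_cast; ring
        · have : KK S * bet S E B + 1 * (KK S * (NN S + KK S)) ≤ cst S A E B C := by
            simp only [cst]; omega
          exact_mod_cast this
      | succ τ =>
        have h1 := hbd τ
        simp only [lens, List.map_cons, dot, dot_shf, term] at h1 ⊢
        simp only [show (0 : ℕ) ≠ τ + 1 by omega, if_false, zero_add]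
        by_cases hτ : (0 : ℕ) = τ
        · simp only [hτ, if_true] at h1 ⊢
          refine (abs_le_of _ _ b0 1 _ _ _ hρa h1 ?_ A 1 hb0abs (by simp)).trans ?_
          · ring
          · have : A * bet S E B + 1 * C ≤ cst S A E B C := by
              simp only [cst]; omega
            exact_mod_cast this
        · simp only [hτ, if_false, zero_add] at h1 ⊢
          refine h1.trans ?_
          have : C ≤ cst S A E B C := by simp only [cst]; omega
          exact_mod_cast this
    · intro u v hu hv hdot
      obtain ⟨κ, e2, u', v', rfl, rfl, hκE, hκ, hu', hv', hdv, hab⟩ := unpack u v hu hv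
      rw [tp_pert_cons, tp_pert_cons]
      have hz : e2 - Y * κ = 0 := by
        have h0 := hdot 0
        simp only [dot, dot_shf_zero, term, if_true, add_zero] at h0
        have hXz : (X : ℤ) ≠ 0 := by positivity
        apply mul_left_cancel₀ hXz
        linarith
      refine geom κ e2 hκE hκ (Or.inl hz) _ _ ?_
      have := hacc u' ((e2 - Y * κ) :: v') hu'
        (List.Forall₂.cons ⟨hdv, hab, Or.inl hz⟩ hv') ?_
      · rwa [tp_pert_cons] at this
      · intro τ
        have h1 := hdot (τ + 1)
        simp only [dot, dot_shf, term, show (0 : ℕ) ≠ τ + 1 by omega, if_false, zero_add] at h1 ⊢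
        rw [h1, hz]; simp

theorem halt_concl (T : S → Sy → Sy → Option (S × Bool × Bool)) (acc : S → Prop) (x y : Sy)
    (D A E B C : ℕ) (s : S) (r1 r2 : ℕ) (U V : List (Sy × ℕ))
    (hlt : ∀ τ, dx T x y s τ < r1 ∧ dy T x y s τ < r2)
    (hB : NN S + E + 1 ≤ B)
    (ha : Acc T acc s (List.replicate r1 x ++ tp U) (List.replicate r2 y ++ tp V)) :
    Concl T acc D A E B C s ((x, r1) :: U) ((y, r2) :: V) := by
  obtain ⟨t, ht1, ht2⟩ := acc_in_cell T x y acc s _ _ ha r1 r2 _ _ rfl rfl hlt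
  have hfix : ∀ m, (nx T x y)^[m + t] s = (nx T x y)^[t] s := by
    intro m
    induction m with
    | zero => simp
    | succ m ih =>
      rw [show m + 1 + t = (m + t) + 1 by ring, Function.iterate_succ_apply', ih]
      simp [nx, ht1]
  have hN : (nx T x y)^[NN S] s = (nx T x y)^[t] s := by
    have h1 := (per_mul T x y s t (NN S) le_rfl).1
    have hk : 0 < KK S := Nat.factorial_pos _
    obtain ⟨m, hm⟩ := Nat.exists_eq_add_of_le' (show t ≤ NN S + t * KK S by nlinarith)
    rw [← h1, hm, hfix]
  refine ⟨List.replicate (U.length + 1) (0,0), List.replicate (V.length + 1) (0,0), by simp, by simp,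
    coef_zero _ _, coef_zero _ _, ?_, ?_⟩
  · intro τ; simp [dot_zero]
  · intro u v hu hv _
    obtain ⟨e1, u', ⟨he1, he1', he1''⟩, hu', rfl⟩ := List.forall₂_cons_left_iff.1 hu
    obtain ⟨e2, v', ⟨he2, he2', he2''⟩, hv', rfl⟩ := List.forall₂_cons_left_iff.1 hv
    rw [tp_pert_cons, tp_pert_cons]
    simp only at he1'' he2'' ⊢
    have hh := hlt (NN S)
    have h1 := dx_le T x y s (NN S)
    have h2 := dy_le T x y s (NN S)
    have g1 : dx T x y s (NN S) < ((r1:ℤ)+e1).toNat := by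
      have := (abs_le.1 he1').1
      rcases he1'' with rfl | h <;> omega
    have g2 : dy T x y s (NN S) < ((r2:ℤ)+e2).toNat := by
      have := (abs_le.1 he2').1
      rcases he2'' with rfl | h <;> omega
    rw [acc_run T x y acc s _ _ _ _ (NN S)]
    · obtain ⟨a, ha⟩ := Nat.exists_eq_add_of_le' (show 1 ≤ ((r1:ℤ)+e1).toNat - dx T x y s (NN S) by omega)
      obtain ⟨b, hb⟩ := Nat.exists_eq_add_of_le' (show 1 ≤ ((r2:ℤ)+e2).toNat - dy T x y s (NN S) by omega)
      rw [ha, hb, hN]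
      simp only [List.replicate_succ, List.cons_append]
      exact Acc.halt ht1 ht2
    · intro τ hτ
      exact ⟨(dx_mono T x y s hτ.le).trans_lt g1, (dy_mono T x y s hτ.le).trans_lt g2⟩

theorem main_concl (Sy : Type) (k : ℕ) : ∃ D A : ℕ, 1 ≤ D ∧ ∀ E : ℕ, ∃ B C : ℕ,
    ∀ (T : S → Sy → Sy → Option (S × Bool × Bool)) (acc : S → Prop) (s : S) (U V : List (Sy × ℕ)),
      U.length + V.length = k → Acc T acc s (tp U) (tp V) → Concl T acc D A E B C s U V := by
  induction k with
  | zero =>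
    refine ⟨1, 0, le_rfl, fun E => ⟨0, 0, ?_⟩⟩
    intro T acc s U V h ha
    have : U = [] := List.length_eq_zero_iff.1 (by omega)
    subst this
    cases ha
  | succ k ih =>
    obtain ⟨D, A, hD, ih⟩ := ih
    refine ⟨D * (KK S).factorial, KK S * A + KK S, Nat.mul_pos hD (Nat.factorial_pos _), fun E => ?_⟩
    obtain ⟨B, C, ih⟩ := ih (E * (1 + KK S))
    refine ⟨B + (NN S + 1 + KK S * E), cst S A E B C, ?_⟩
    intro T acc s U V h ha
    have hk : 1 * E ≤ KK S * E := Nat.mul_le_mul_right _ (Nat.factorial_pos _)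
    rcases U with _ | ⟨⟨x, r1⟩, U⟩
    · cases ha
    rcases V with _ | ⟨⟨y, r2⟩, V⟩
    · exact absurd ha acc_nil_right
    have ha' : Acc T acc s (List.replicate r1 x ++ tp U) (List.replicate r2 y ++ tp V) := by
      simpa [tp] using ha
    by_cases hlt : ∀ τ, dx T x y s τ < r1 ∧ dy T x y s τ < r2
    · exact halt_concl T acc x y _ _ _ _ _ s r1 r2 U V hlt (by omega) ha'
    · have hex : ∃ τ, ¬ (dx T x y s τ < r1 ∧ dy T x y s τ < r2) := by
        by_contra hcon; push Not at hcon; exact hlt hcon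
      classical
      obtain ⟨t, ht, hmin⟩ : ∃ t, ¬ (dx T x y s t < r1 ∧ dy T x y s t < r2) ∧
          ∀ τ < t, dx T x y s τ < r1 ∧ dy T x y s τ < r2 :=
        ⟨Nat.find hex, Nat.find_spec hex, fun τ hτ => not_not.1 (Nat.find_min hex hτ)⟩
      have hrun := (acc_run T x y acc s r1 r2 (tp U) (tp V) t hmin).1 ha'
      -- previous step
      have hle : t ≠ 0 → dx T x y s t ≤ r1 ∧ dy T x y s t ≤ r2 := by
        intro h0
        obtain ⟨t, rfl⟩ := Nat.exists_eq_succ_of_ne_zero h0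
        have := hmin t (by omega)
        have h1 := mx_le T x y ((nx T x y)^[t] s)
        have h2 := my_le T x y ((nx T x y)^[t] s)
        rw [Nat.succ_eq_add_one, dx_succ, dy_succ]; omega
      have hle : dx T x y s t ≤ r1 ∧ dy T x y s t ≤ r2 := by
        by_cases h0 : t = 0
        · subst h0; simp [dx, dy]
        · exact hle h0
      by_cases hup : dx T x y s t = r1
      · refine exit_concl T acc x y D A E B C s r1 r2 t U V hup hle.2 hmin (ih _ _ _ _ _ ?_ ?_)
        · simp at h ⊢; omega
        · rw [hup] at hrun; simpa [tp] using hrun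
      · have hlo : dy T x y s t = r2 := by omega
        have := exit_concl (swp T) acc y x D A E B C s r2 r1 t V U (by rw [dx_swp]; exact hlo)
          (by rw [dy_swp]; exact hle.1) (fun τ hτ => by
            rw [dx_swp, dy_swp]; exact (hmin τ hτ).symm) (ih _ _ _ _ _ ?_ ?_)
        · simpa [swp_swp] using this.swap
        · simp at h ⊢; omega
        · rw [hlo] at hrun
          rw [nx_swp, dy_swp]
          simpa [tp] using hrun.swap

end main

theorem lin_zero (P Q R n m C A : ℤ) (h : |P * n + Q * m + R| ≤ C) (hQ : |Q| ≤ 2 * A)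
    (hR : |R| ≤ 2 * A) (hA : 0 ≤ A) (hC : 0 ≤ C) (hm : C + 2 * A < m)
    (hn : 2 * A * m + C + 2 * A < n) :
    P = 0 ∧ Q = 0 := by
  have hm0 : 0 < m := by linarith
  have hn0 : 0 < n := by nlinarith
  have hQm : |Q * m| ≤ 2 * A * m := by
    rw [abs_mul, abs_of_pos hm0]; exact mul_le_mul_of_nonneg_right hQ hm0.le
  rw [abs_le] at h hR hQm
  have hP : P = 0 := by
    by_contra hne
    rcases lt_or_gt_of_ne hne with h0 | h0
    · have : P * n ≤ (-1) * n := mul_le_mul_of_nonneg_right (by omega) hn0.le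
      linarith [h.1, hR.2, hQm.2]
    · have : 1 * n ≤ P * n := mul_le_mul_of_nonneg_right (by omega) hn0.le
      linarith [h.2, hR.1, hQm.1]
  refine ⟨hP, ?_⟩
  subst hP
  by_contra hne
  rcases lt_or_gt_of_ne hne with h0 | h0
  · have : Q * m ≤ (-1) * m := mul_le_mul_of_nonneg_right (by omega) hm0.le
    linarith [h.1, hR.2]
  · have : 1 * m ≤ Q * m := mul_le_mul_of_nonneg_right (by omega) hm0.le
    linarith [h.2, hR.1]

/-- coefficient of label `t` -/
def lc (t : ℕ) (c : ℕ × ℕ) : ℤ := if c.2 = t then (c.1 : ℤ) else 0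

theorem term_lc (t : ℕ) (c : ℕ × ℕ) (e : ℤ) : term t c e = lc t c * e := by
  simp only [term, lc]; split_ifs <;> simp

theorem lc_nonneg (t : ℕ) (c : ℕ × ℕ) : 0 ≤ lc t c := by
  simp only [lc]; split_ifs <;> simp

theorem lc_le {A : ℕ} (t : ℕ) (c : ℕ × ℕ) (h : c.1 ≤ A) : lc t c ≤ A := by
  simp only [lc]; split_ifs
  · exact_mod_cast h
  · simp

theorem lc_ne {t : ℕ} {c : ℕ × ℕ} (h : lc t c ≠ 0) : c.2 = t := by
  by_contra hne; exact h (by simp [lc, hne])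

theorem list_six {X : Type} (l : List X) (h : l.length = 6) :
    ∃ a b c d e f, l = [a, b, c, d, e, f] := by
  match l, h with
  | [a, b, c, d, e, f], _ => exact ⟨a, b, c, d, e, f, rfl⟩

set_option maxHeartbeats 1000000 in
theorem no_machine [Fintype S] (T : S → Sy → Sy → Option (S × Bool × Bool)) (acc : S → Prop)
    (s : S) (l a b r : Sy)
    (H : ∀ n1 n2 n3 n4 : ℕ, 1 ≤ n1 → 1 ≤ n2 → 1 ≤ n3 → 1 ≤ n4 →
      (Acc T acc s (tp [(l, 1), (a, n1), (b, n2), (a, n3), (b, n4), (r, 1)])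
        (tp [(r, 1), (b, n4), (a, n3), (b, n2), (a, n1), (l, 1)]) ↔ n1 = n2 ∧ n3 = n4)) :
    False := by
  obtain ⟨D, A, hD, hmain⟩ := main_concl (S := S) Sy 12
  obtain ⟨B, C, hmain⟩ := hmain ((A + 1) * D)
  obtain ⟨m, hm⟩ : ∃ m : ℕ, m = B + C + 2 * A + (A + 1) * D + 1 := ⟨_, rfl⟩
  obtain ⟨n, hn⟩ : ∃ n : ℕ, n = 2 * A * m + C + 2 * A + m + 1 := ⟨_, rfl⟩
  have hnm : m ≤ n := by rw [hn]; nlinarith [Nat.zero_le (A * m)]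
  obtain ⟨cu, cv, hlu, hlv, hcu, hcv, hbd, hacc⟩ := hmain T acc s _ _ (by simp)
    ((H n n m m (by omega) (by omega) (by omega) (by omega)).2 ⟨rfl, rfl⟩)
  obtain ⟨c0, c1, c2, c3, c4, c5, rfl⟩ := list_six cu (by simpa using hlu)
  obtain ⟨d0, d1, d2, d3, d4, d5, rfl⟩ := list_six cv (by simpa using hlv)
  have hcA := hcu.1
  have hdA := hcv.1
  have hcP := hcu.2.1
  have hdP := hcv.2.1
  simp only [List.mem_cons, List.not_mem_nil, or_false, forall_eq_or_imp, forall_eq] at hcA hdA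
  simp only [List.pairwise_cons, List.mem_cons, List.not_mem_nil, or_false, forall_eq_or_imp,
    forall_eq] at hcP hdP
  have key : ∀ t, lc t c1 + lc t c2 - lc t d3 - lc t d4 = 0 ∧
      lc t c3 + lc t c4 - lc t d1 - lc t d2 = 0 := by
    intro t
    have h := hbd t
    simp only [dot, lens, List.map_cons, List.map_nil, term_lc] at h
    have e0 := lc_le t c0 hcA.1
    have e3 := lc_le t c3 hcA.2.2.2.1
    have e4 := lc_le t c4 hcA.2.2.2.2.1
    have e5 := lc_le t c5 hcA.2.2.2.2.2
    have f0 := lc_le t d0 hdA.1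
    have f1 := lc_le t d1 hdA.2.1
    have f2 := lc_le t d2 hdA.2.2.1
    have f5 := lc_le t d5 hdA.2.2.2.2.2
    have := lc_nonneg t c0
    have := lc_nonneg t c3
    have := lc_nonneg t c4
    have := lc_nonneg t c5
    have := lc_nonneg t d0
    have := lc_nonneg t d1
    have := lc_nonneg t d2
    have := lc_nonneg t d5
    refine lin_zero _ _ (lc t c0 + lc t c5 - lc t d0 - lc t d5) n m C A ?_ ?_ ?_ ?_ ?_ ?_ ?_
    · convert h using 2
      push_cast; ring
    · rw [abs_le]; constructor <;> omega
    · rw [abs_le]; constructor <;> omega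
    · positivity
    · positivity
    · have : C + 2 * A < m := by rw [hm]; nlinarith [Nat.zero_le ((A+1) * D)]
      exact_mod_cast this
    · have : 2 * A * m + C + 2 * A < n := by omega
      exact_mod_cast this
  -- perturbation
  have final : ∀ x y : ℤ, |x| ≤ A + 1 → |y| ≤ A + 1 → (x ≠ 0 ∨ y ≠ 0) →
      (∀ t, (lc t c1 - lc t d4) * x + (lc t c3 - lc t d2) * y = 0) → False := by
    intro x y hx hy hxy hzero
    have hv0 : ∀ N : ℕ, (D : ℤ) ∣ (0:ℤ) ∧ |(0:ℤ)| ≤ ((A + 1) * D : ℕ) ∧ ((0:ℤ) = 0 ∨ B ≤ N) :=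
      fun N => ⟨dvd_zero _, by rw [abs_zero]; positivity, Or.inl rfl⟩
    have hv : ∀ z : ℤ, |z| ≤ A + 1 → ∀ N : ℕ, m ≤ N →
        (D : ℤ) ∣ z * D ∧ |z * D| ≤ ((A + 1) * D : ℕ) ∧ (z * D = 0 ∨ B ≤ N) := by
      intro z hz N hN
      refine ⟨Dvd.intro_left _ rfl, ?_, Or.inr (by omega)⟩
      rw [abs_mul, Nat.abs_cast]; push_cast
      exact mul_le_mul_of_nonneg_right hz (by positivity)
    have hx' := hv x hx n hnm
    have hy' := hv y hy m le_rfl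
    have hac := hacc [0, x * D, 0, y * D, 0, 0] [0, 0, y * D, 0, x * D, 0]
      (.cons (hv0 _) (.cons hx' (.cons (hv0 _) (.cons hy' (.cons (hv0 _) (.cons (hv0 _) .nil))))))
      (.cons (hv0 _) (.cons (hv0 _) (.cons hy' (.cons (hv0 _) (.cons hx' (.cons (hv0 _) .nil))))))
      (by
        intro t
        simp only [dot, term_lc]
        linear_combination D * hzero t)
    simp only [pert, List.zipWith_cons_cons, List.zipWith_nil_left, add_zero, Int.toNat_natCast] at hac
    have hx1 := (abs_le.1 hx'.2.1).1
    have hy1 := (abs_le.1 hy'.2.1).1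
    have h2 := (H _ _ _ _ (by omega) (by omega) (by omega) (by omega)).1 hac
    have hDz : (D : ℤ) ≠ 0 := by positivity
    rcases hxy with h | h
    · have := mul_ne_zero h hDz
      omega
    · have := mul_ne_zero h hDz
      omega
  by_cases hf : ∀ t, lc t c1 - lc t d4 = 0
  · exact final 1 0 (by simp) (by simp; positivity) (by simp) (fun t => by simp [hf t])
  by_cases hg : ∀ t, lc t c3 - lc t d2 = 0
  · exact final 0 1 (by simp; positivity) (by simp) (by simp) (fun t => by simp [hg t])
  push Not at hf hg
  obtain ⟨p, hp⟩ := hf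
  have locf : ∀ t, lc t c1 - lc t d4 ≠ 0 → (c1.2 = t ∨ c2.2 = t) ∧ (d3.2 = t ∨ d4.2 = t) := by
    intro t ht
    have h := (key t).1
    have := lc_nonneg t c1
    have := lc_nonneg t c2
    have := lc_nonneg t d3
    have := lc_nonneg t d4
    constructor
    · by_contra hcon
      push Not at hcon
      have e1 : lc t c1 = 0 := by simp [lc, hcon.1]
      have e2 : lc t c2 = 0 := by simp [lc, hcon.2]
      omega
    · by_contra hcon
      push Not at hcon
      have e1 : lc t d3 = 0 := by simp [lc, hcon.1]
      have e2 : lc t d4 = 0 := by simp [lc, hcon.2]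
      omega
  have locg : ∀ t, lc t c3 - lc t d2 ≠ 0 → (c3.2 = t ∨ c4.2 = t) ∧ (d1.2 = t ∨ d2.2 = t) := by
    intro t ht
    have h := (key t).2
    have := lc_nonneg t c3
    have := lc_nonneg t c4
    have := lc_nonneg t d1
    have := lc_nonneg t d2
    constructor
    · by_contra hcon
      push Not at hcon
      have e1 : lc t c3 = 0 := by simp [lc, hcon.1]
      have e2 : lc t c4 = 0 := by simp [lc, hcon.2]
      omega
    · by_contra hcon
      push Not at hcon
      have e1 : lc t d1 = 0 := by simp [lc, hcon.1]
      have e2 : lc t d2 = 0 := by simp [lc, hcon.2]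
      omega
  have same : ∀ s t, lc s c1 - lc s d4 ≠ 0 → lc t c3 - lc t d2 ≠ 0 → s = t := by
    intro s t hs ht
    have h1 := locf s hs
    have h2 := locg t ht
    omega
  obtain ⟨q, hq⟩ := hg
  have hpq := same p q hp hq
  subst hpq
  have e1 := lc_le p c1 hcA.2.1
  have e3 := lc_le p c3 hcA.2.2.2.1
  have f2 := lc_le p d2 hdA.2.2.1
  have f4 := lc_le p d4 hdA.2.2.2.2.1
  have := lc_nonneg p c1
  have := lc_nonneg p c3
  have := lc_nonneg p d2
  have := lc_nonneg p d4
  refine final (lc p c3 - lc p d2) (-(lc p c1 - lc p d4)) ?_ ?_ (Or.inl hq) ?_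
  · rw [abs_le]; constructor <;> omega
  · rw [abs_le]; constructor <;> omega
  · intro t
    by_cases htp : t = p
    · subst htp; ring
    · have h1 : lc t c1 - lc t d4 = 0 := by
        by_contra hne; exact htp (same t p hne hq)
      have h2 : lc t c3 - lc t d2 = 0 := by
        by_contra hne; exact htp (same p t hp hne).symm
      rw [h1, h2]; ring

end TT

namespace WKSim
open WK

/-- The whole tape as a list. -/
def ft {α : Type} (w : List α) : List (TSym α) := (Sum.inr false :: w.map Sum.inl) ++ [Sum.inr true]

theorem ft_length {α : Type} (w : List α) : (ft w).length = w.length + 2 := by simp [ft]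

theorem tape_eq {α : Type} (w : List α) (k : ℕ) (h : k < (ft w).length) : tape w k = (ft w)[k] := by
  unfold tape
  exact List.getD_eq_getElem _ _ h

theorem tape_right {α : Type} (w : List α) (k : ℕ) (h : w.length + 1 ≤ k) :
    tape w k = Sum.inr true := by
  rcases Nat.eq_or_lt_of_le h with h | h
  · rw [tape_eq w k (by rw [ft_length]; omega)]
    subst h
    simp [ft]
  · unfold tape
    exact List.getD_eq_default _ _ (by simp; omega)

theorem tape_zero {α : Type} (w : List α) : tape w 0 = Sum.inr false := rfl

theorem tape_mid {α : Type} (w : List α) (k : ℕ) (h1 : k < w.length) :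
    tape w (k + 1) = Sum.inl w[k] := by
  rw [tape_eq w (k + 1) (by rw [ft_length]; omega)]
  simp [ft, h1]

theorem tape_left_iff {α : Type} (w : List α) (k : ℕ) : tape w k = Sum.inr false ↔ k = 0 := by
  constructor
  · intro h
    rcases k with _ | k
    · rfl
    · by_cases hk : k < w.length
      · rw [tape_mid w k hk] at h; cases h
      · rw [tape_right w _ (by omega)] at h; cases h
  · rintro rfl; rfl

theorem tape_right_iff {α : Type} (w : List α) (k : ℕ) :
    tape w k = Sum.inr true ↔ w.length + 1 ≤ k := by
  constructor
  · intro h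
    rcases k with _ | k
    · cases h
    · by_cases hk : k < w.length
      · rw [tape_mid w k hk] at h; cases h
      · omega
  · exact tape_right w k

def up {α : Type} (w : List α) (i : ℕ) : List (TSym α) := (ft w).drop (min i (w.length + 1))
def lo {α : Type} (w : List α) (j : ℕ) : List (TSym α) := ((ft w).take (j + 1)).reverse

theorem up_cons {α : Type} (w : List α) (i : ℕ) : ∃ U, up w i = tape w i :: U := by
  have hlt : min i (w.length + 1) < (ft w).length := by rw [ft_length]; omega
  refine ⟨(ft w).drop (min i (w.length + 1) + 1), ?_⟩
  rw [up, List.drop_eq_getElem_cons hlt, ← tape_eq]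
  congr 1
  rcases le_total i (w.length + 1) with h | h
  · rw [min_eq_left h]
  · rw [min_eq_right h, tape_right w i h, tape_right w _ le_rfl]

theorem lo_cons {α : Type} (w : List α) (j : ℕ) (hj : j ≤ w.length + 1) :
    ∃ V, lo w j = tape w j :: V := by
  have hlt : j < (ft w).length := by rw [ft_length]; omega
  refine ⟨((ft w).take j).reverse, ?_⟩
  rw [lo, List.take_succ_eq_append_getElem hlt, ← tape_eq]
  simp

theorem lo_drop {α : Type} (w : List α) (j : ℕ) (hj : j + 1 ≤ w.length + 1) :
    (lo w (j + 1)).drop 1 = lo w j := by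
  have hlt : j + 1 < (ft w).length := by rw [ft_length]; omega
  rw [lo, List.take_succ_eq_append_getElem hlt, List.reverse_append]
  rfl

theorem up_drop {α : Type} (w : List α) (i : ℕ) (d : Bool) (e : Bool)
    (he : e = true ↔ d = true ∧ tape w i ≠ Sum.inr true) :
    (up w i).drop (cond e 1 0) = up w (i + cond d 1 0) := by
  rw [Ne, tape_right_iff] at he
  unfold up
  rw [List.drop_drop]
  congr 1
  cases d <;> cases e <;> simp at he ⊢ <;> omega

open Classical in
/-- The abstract transition function simulating a system. -/
noncomputable def TM {α : Type} (A : DPWK α) (s : A.Q1 × A.Q2) (x y : TSym α) :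
    Option ((A.Q1 × A.Q2) × Bool × Bool) :=
  match A.δ1 s.1 x (A.μ2 s.2 y), A.δ2 s.2 y (A.μ1 s.1 x) with
  | some (p', d1), some (q', d2) =>
    if y = Sum.inr false ∧ d2 = true then none
    else some ((p', q'), decide (d1 = true ∧ x ≠ Sum.inr true), d2)
  | _, _ => none

def ac {α : Type} (A : DPWK α) (s : A.Q1 × A.Q2) : Prop := s.1 ∈ A.F1 ∨ s.2 ∈ A.F2

theorem step_TM {α : Type} {A : DPWK α} {w : List α} {c c' : Config A} (h : Step A w c c') :
    ∃ d1 e1 d2 : Bool, TM A (c.p, c.q) (tape w c.i) (tape w c.j) = some ((c'.p, c'.q), e1, d2) ∧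
      (e1 = true ↔ d1 = true ∧ tape w c.i ≠ Sum.inr true) ∧
      c'.i = c.i + (cond d1 1 0) ∧ c.j = c'.j + (cond d2 1 0) := by
  obtain ⟨d1, d2, h1, h2, h3, h4⟩ := h
  classical
  refine ⟨d1, decide (d1 = true ∧ tape w c.i ≠ Sum.inr true), d2, ?_, by simp, h3, h4⟩
  have hn : ¬ (tape w c.j = Sum.inr false ∧ d2 = true) := by
    rw [tape_left_iff]
    rintro ⟨h, rfl⟩
    simp at h4; omega
  simp only [TM, h1, h2, hn, if_false]

theorem TM_step {α : Type} {A : DPWK α} {w : List α} {c : Config A} {s' : A.Q1 × A.Q2}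
    {e1 d2 : Bool} (h : TM A (c.p, c.q) (tape w c.i) (tape w c.j) = some (s', e1, d2)) :
    ∃ c' : Config A, Step A w c c' ∧ s' = (c'.p, c'.q) ∧ ∃ d1 : Bool,
      (e1 = true ↔ d1 = true ∧ tape w c.i ≠ Sum.inr true) ∧
      c'.i = c.i + (cond d1 1 0) ∧ c.j = c'.j + (cond d2 1 0) := by
  simp only [TM] at h
  rcases h1 : A.δ1 c.p (tape w c.i) (A.μ2 c.q (tape w c.j)) with _ | ⟨p', d1⟩
  · simp [h1] at h
  rcases h2 : A.δ2 c.q (tape w c.j) (A.μ1 c.p (tape w c.i)) with _ | ⟨q', d2'⟩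
  · simp [h1, h2] at h
  simp only [h1, h2] at h
  by_cases hn : tape w c.j = Sum.inr false ∧ d2' = true
  · simp [hn] at h
  · rw [if_neg hn] at h
    simp only [Option.some.injEq, Prod.mk.injEq] at h
    obtain ⟨rfl, rfl, rfl⟩ := h
    have hj : c.j = (c.j - cond d2' 1 0) + cond d2' 1 0 := by
      rw [tape_left_iff] at hn
      cases d2' <;> simp at hn ⊢; omega
    refine ⟨⟨p', c.i + cond d1 1 0, q', c.j - cond d2' 1 0⟩, ⟨d1, d2', h1, h2, rfl, hj⟩, rfl, d1,
      by simp, rfl, hj⟩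

def AccFrom {α : Type} (A : DPWK α) (w : List α) (c : Config A) : Prop :=
  ∃ c', Relation.ReflTransGen (Step A w) c c' ∧ Halted A w c' ∧ AccConf A c'

theorem accepts_iff {α : Type} (A : DPWK α) (w : List α) :
    Accepts A w ↔ AccFrom A w (initConf A w) := by
  constructor
  · rintro ⟨cs, h1, h2, c, h3, h4, h5⟩
    refine ⟨c, ?_, h4, h5⟩
    cases cs with
    | nil => simp at h1
    | cons a l =>
      simp only [List.head?_cons, Option.some.injEq] at h1
      subst h1
      refine List.relationReflTransGen_of_exists_isChain_cons l h2 ?_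
      rw [List.getLast?_eq_some_getLast (List.cons_ne_nil _ _)] at h3
      exact Option.some.inj h3
  · rintro ⟨c, h1, h2, h3⟩
    obtain ⟨l, hl, hc⟩ := List.exists_isChain_cons_of_relationReflTransGen h1
    refine ⟨_ :: l, rfl, hl, c, ?_, h2, h3⟩
    rw [List.getLast?_eq_some_getLast (List.cons_ne_nil _ _), hc]

theorem sim_fwd {α : Type} (A : DPWK α) (w : List α) (c : Config A) (h : AccFrom A w c) :
    c.j ≤ w.length + 1 → TT.Acc (TM A) (ac A) (c.p, c.q) (up w c.i) (lo w c.j) := by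
  obtain ⟨c', h, hh, ha⟩ := h
  induction h using Relation.ReflTransGen.head_induction_on with
  | refl =>
    intro hj
    obtain ⟨U, hU⟩ := up_cons w c'.i
    obtain ⟨V, hV⟩ := lo_cons w c'.j hj
    rw [hU, hV]
    refine TT.Acc.halt ?_ ha
    by_contra hne
    obtain ⟨⟨s', e1, d2⟩, hs⟩ := Option.ne_none_iff_exists'.1 hne
    obtain ⟨c'', hs, _⟩ := TM_step hs
    exact hh ⟨_, hs⟩
  | @head a b hs _ ih =>
    intro hj
    obtain ⟨d1, e1, d2, h1, h2, h3, h4⟩ := step_TM hs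
    have ih := ih (by omega)
    obtain ⟨U, hU⟩ := up_cons w a.i
    obtain ⟨V, hV⟩ := lo_cons w a.j hj
    rw [hU, hV]
    refine TT.Acc.step h1 ?_
    rw [← hU, ← hV, up_drop w a.i d1 e1 h2, ← h3]
    convert ih using 1
    cases d2 with
    | false => simp at h4 ⊢; rw [h4]
    | true =>
      simp at h4 ⊢; rw [h4] at hj ⊢
      simpa using lo_drop w b.j hj

theorem sim_bwd {α : Type} (A : DPWK α) (w : List α) (s : A.Q1 × A.Q2) (U V : List (TSym α))
    (h : TT.Acc (TM A) (ac A) s U V) : ∀ c : Config A, c.j ≤ w.length + 1 → s = (c.p, c.q) →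
      U = up w c.i → V = lo w c.j → AccFrom A w c := by
  induction h with
  | halt h1 h2 =>
    rintro c hj rfl hU hV
    obtain ⟨U', hU'⟩ := up_cons w c.i
    obtain ⟨V', hV'⟩ := lo_cons w c.j hj
    rw [hU'] at hU; rw [hV'] at hV
    obtain ⟨rfl, rfl⟩ := List.cons.inj hU
    obtain ⟨rfl, rfl⟩ := List.cons.inj hV
    refine ⟨c, .refl, ?_, h2⟩
    rintro ⟨c', hs⟩
    obtain ⟨d1, e1, d2, h3, _⟩ := step_TM hs
    rw [h1] at h3; cases h3
  | step h1 _ ih =>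
    rename_i d1 d2 _
    rintro c hj rfl hU hV
    obtain ⟨U', hU'⟩ := up_cons w c.i
    obtain ⟨V', hV'⟩ := lo_cons w c.j hj
    rw [hU'] at hU; rw [hV'] at hV
    obtain ⟨rfl, rfl⟩ := List.cons.inj hU
    obtain ⟨rfl, rfl⟩ := List.cons.inj hV
    obtain ⟨c', hs, h2, d, h3, h4, h5⟩ := TM_step h1
    obtain ⟨f, g1, g2⟩ := ih c' (by omega) h2
      (by rw [← hU', h4]; exact up_drop w _ _ _ h3)
      (by
        rw [← hV']
        cases d2 with
        | false => simp at h5 ⊢; rw [h5]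
        | true =>
          simp at h5 ⊢; rw [h5] at hj ⊢
          simpa using lo_drop w c'.j hj)
    exact ⟨f, .head hs g1, g2⟩

theorem accepts_iff_acc {α : Type} (A : DPWK α) (w : List α) :
    Accepts A w ↔ TT.Acc (TM A) (ac A) (A.q01, A.q02) (ft w) (ft w).reverse := by
  have h1 : up w 0 = ft w := by simp [up]
  have h2 : lo w (w.length + 1) = (ft w).reverse := by
    rw [lo, List.take_of_length_le]; rw [ft_length]
  rw [accepts_iff]
  constructor
  · intro h
    have := sim_fwd A w _ h (by simp [initConf])
    simpa only [initConf, h1, h2] using this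
  · intro h
    exact sim_bwd A w _ _ _ h (initConf A w) (by simp [initConf]) rfl h1.symm h2.symm

theorem not_accepts (A : DPWK Bool) (H : ∀ n1 n2 n3 n4 : ℕ, 1 ≤ n1 → 1 ≤ n2 → 1 ≤ n3 → 1 ≤ n4 →
    (Accepts A (List.replicate n1 false ++ List.replicate n2 true ++
      (List.replicate n3 false ++ List.replicate n4 true)) ↔ n1 = n2 ∧ n3 = n4)) : False := by
  have := A.fQ1
  have := A.fQ2
  refine TT.no_machine (TM A) (ac A) (A.q01, A.q02) (Sum.inr false) (Sum.inl false) (Sum.inl true)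
    (Sum.inr true) ?_
  intro n1 n2 n3 n4 h1 h2 h3 h4
  rw [← H n1 n2 n3 n4 h1 h2 h3 h4, accepts_iff_acc]
  simp [TT.tp, ft]

end WKSim

namespace WKSim

theorem peel {X : Type} (x : X) (n m : ℕ) (U V : List X)
    (hU : U.head? ≠ some x) (hV : V.head? ≠ some x)
    (h : List.replicate n x ++ U = List.replicate m x ++ V) : n = m ∧ U = V := by
  induction n generalizing m with
  | zero =>
    cases m with
    | zero => simpa using h
    | succ m => simp [List.replicate_succ] at h; simp [h] at hU
  | succ n ih =>
    cases m with
    | zero => simp [List.replicate_succ] at h; simp [← h] at hV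
    | succ m =>
      simp only [List.replicate_succ, List.cons_append, List.cons.injEq, true_and] at h
      have := ih m h
      exact ⟨by omega, this.2⟩

theorem head_rep {X : Type} (x : X) (n : ℕ) (hn : 1 ≤ n) (U : List X) :
    (List.replicate n x ++ U).head? = some x := by
  obtain ⟨k, rfl⟩ := Nat.exists_eq_add_of_le' hn
  simp [List.replicate_succ]

theorem star_head (ls : List (List Bool)) (h : ∀ u ∈ ls, u ∈ Lab) :
    ls.flatten.head? ≠ some true := by
  cases ls with
  | nil => simp
  | cons u ls =>
    obtain ⟨n, hn, rfl⟩ := h u (by simp)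
    rw [List.flatten_cons, List.append_assoc, head_rep _ _ hn]; simp

/-- peel one block off a word in the star -/
theorem star_peel (n m : ℕ) (hn : 1 ≤ n) (hm : 1 ≤ m) (W : List Bool) (hW : W.head? ≠ some true)
    (ls : List (List Bool)) (h : ∀ u ∈ ls, u ∈ Lab)
    (he : List.replicate n false ++ (List.replicate m true ++ W) = ls.flatten) :
    n = m ∧ ∃ ls' : List (List Bool), (∀ u ∈ ls', u ∈ Lab) ∧ W = ls'.flatten := by
  cases ls with
  | nil =>
    have := congrArg List.head? he
    rw [head_rep _ _ hn] at this; simp at this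
  | cons u ls =>
    obtain ⟨k, hk, rfl⟩ := h u (by simp)
    have h' : ∀ u ∈ ls, u ∈ Lab := fun v hv => h v (by simp [hv])
    rw [List.flatten_cons, List.append_assoc] at he
    obtain ⟨h1, h2⟩ := peel _ _ _ _ _ (by rw [head_rep _ _ hm]; simp)
      (by rw [head_rep _ _ hk]; simp) he
    obtain ⟨h3, h4⟩ := peel _ _ _ _ _ hW (star_head ls h') h2
    exact ⟨by omega, ls, h', h4⟩

theorem star_iff (n1 n2 n3 n4 : ℕ) (h1 : 1 ≤ n1) (h2 : 1 ≤ n2) (h3 : 1 ≤ n3) (h4 : 1 ≤ n4)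
    (h : (List.replicate n1 false ++ List.replicate n2 true ++
      (List.replicate n3 false ++ List.replicate n4 true)) ∈ LabStar) : n1 = n2 ∧ n3 = n4 := by
  obtain ⟨ls, hls, he⟩ := h
  rw [List.append_assoc] at he
  obtain ⟨e1, ls', hls', he'⟩ := star_peel n1 n2 h1 h2 _ (by rw [head_rep _ _ h3]; simp) ls hls he
  obtain ⟨e2, _⟩ := star_peel n3 n4 h3 h4 [] (by simp) ls' hls' (by rw [← he']; simp)
  exact ⟨e1, e2⟩

theorem lablab_sub {w : List Bool} (h : w ∈ LabLab) : w ∈ LabStar := by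
  obtain ⟨u, hu, v, hv, rfl⟩ := h
  refine ⟨[u, v], ?_, by simp⟩
  intro x hx
  simp at hx
  rcases hx with rfl | rfl
  · exact hu
  · exact hv

theorem mem_lablab (n m : ℕ) (hn : 1 ≤ n) (hm : 1 ≤ m) :
    (List.replicate n false ++ List.replicate n true ++
      (List.replicate m false ++ List.replicate m true)) ∈ LabLab :=
  ⟨_, ⟨n, hn, rfl⟩, _, ⟨m, hm, rfl⟩, rfl⟩

theorem ne_lablab (A : WK.DPWK Bool) : WK.lang A ≠ LabLab := by
  intro h
  refine not_accepts A fun n1 n2 n3 n4 h1 h2 h3 h4 => ?_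
  change _ ∈ WK.lang A ↔ _
  rw [h]
  constructor
  · intro hw; exact star_iff n1 n2 n3 n4 h1 h2 h3 h4 (lablab_sub hw)
  · rintro ⟨rfl, rfl⟩; exact mem_lablab _ _ h1 h3

theorem ne_labstar (A : WK.DPWK Bool) : WK.lang A ≠ LabStar := by
  intro h
  refine not_accepts A fun n1 n2 n3 n4 h1 h2 h3 h4 => ?_
  change _ ∈ WK.lang A ↔ _
  rw [h]
  constructor
  · intro hw; exact star_iff n1 n2 n3 n4 h1 h2 h3 h4 hw
  · rintro ⟨rfl, rfl⟩; exact lablab_sub (mem_lablab _ _ h1 h3)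

end WKSim

namespace WKLab
open WK

abbrev Tab := Fin 4 → TSym Bool → TSym Bool → Option (Fin 4 × Bool × Bool)
abbrev Msg := Fin 4 × TSym Bool

def mu (p : Fin 4) (x : TSym Bool) : Option Msg := some (p, x)

def del1 (T : Tab) (p : Fin 4) (x : TSym Bool) : Option Msg → Option (Fin 4 × Bool)
  | some (q, y) => if q = p then (T p x y).map fun z => (z.1, z.2.1) else none
  | none => none

def del2 (T : Tab) (q : Fin 4) (y : TSym Bool) : Option Msg → Option (Fin 4 × Bool)
  | some (p, x) => if p = q then (T q x y).map fun z => (z.1, z.2.2) else none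
  | none => none

/-- The joint transition table. -/
def tab : Tab
  | 0, .inr false, .inr true => some (1, false, true)
  | 1, .inr false, .inl true => some (1, true, true)
  | 1, .inl false, .inl true => some (1, true, true)
  | 1, .inl false, .inl false => some (2, true, true)
  | 2, .inl true, .inl false => some (2, true, true)
  | 2, .inl true, .inr false => some (3, false, false)
  | _, _, _ => none

/-- The joint reverse table. -/
def rtab : Tab
  | 1, .inr false, .inr true => some (0, false, true)
  | 1, .inr false, .inl true => some (1, true, true)
  | 1, .inl false, .inl true => some (1, true, true)
  | 2, .inl false, .inl false => some (1, true, true)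
  | 2, .inl true, .inl false => some (2, true, true)
  | 3, .inl true, .inr false => some (2, false, false)
  | _, _, _ => none

set_option maxRecDepth 100000 in
theorem tab_rtab : ∀ (s s' : Fin 4) (x y : TSym Bool) (d1 d2 : Bool),
    rtab s' x y = some (s, d1, d2) ↔ tab s x y = some (s', d1, d2) := by
  decide

theorem joint (T : Tab) (p q p' q' : Fin 4) (x y : TSym Bool) (d1 d2 : Bool) :
    (del1 T p x (mu q y) = some (p', d1) ∧ del2 T q y (mu p x) = some (q', d2)) ↔
      p = q ∧ p' = q' ∧ T p x y = some (p', d1, d2) := by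
  simp only [del1, del2, mu]
  by_cases h : p = q
  · subst h
    rcases T p x y with _ | ⟨s, e1, e2⟩
    · simp
    · simp only [if_true, Option.map_some, Option.some.injEq, Prod.mk.injEq, true_and]
      constructor
      · rintro ⟨⟨rfl, rfl⟩, rfl, rfl⟩; simp
      · rintro ⟨rfl, rfl, rfl, rfl⟩; simp
  · have h' : ¬ q = p := fun e => h e.symm
    simp [h, h']

/-- The machine. -/
def mach : DPWK Bool where
  M := Msg
  Q1 := Fin 4
  Q2 := Fin 4
  fM := inferInstance
  fQ1 := inferInstance
  fQ2 := inferInstance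
  δ1 := del1 tab
  δ2 := del2 tab
  μ1 := mu
  μ2 := mu
  q01 := 0
  q02 := 0
  F1 := {3}
  F2 := {3}

/-- states of a configuration, as elements of `Fin 4` -/
def st1 (c : Config mach) : Fin 4 := c.p
def st2 (c : Config mach) : Fin 4 := c.q

theorem step_iff (w : List Bool) (c c' : Config mach) : Step mach w c c' ↔
    ∃ d1 d2 : Bool, st1 c = st2 c ∧ st1 c' = st2 c' ∧
      tab (st1 c) (tape w c.i) (tape w c.j) = some (st1 c', d1, d2) ∧
      c'.i = c.i + (cond d1 1 0) ∧ c.j = c'.j + (cond d2 1 0) := by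
  unfold Step
  refine exists_congr fun d1 => exists_congr fun d2 => ?_
  have := joint tab c.p c.q c'.p c'.q (tape w c.i) (tape w c.j) d1 d2
  constructor
  · rintro ⟨h1, h2, h3⟩
    obtain ⟨g1, g2, g3⟩ := this.1 ⟨h1, h2⟩
    exact ⟨g1, g2, g3, h3⟩
  · rintro ⟨g1, g2, g3, h3⟩
    obtain ⟨h1, h2⟩ := this.2 ⟨g1, g2, g3⟩
    exact ⟨h1, h2, h3⟩

theorem back_iff (w : List Bool) (c c' : Config mach) :
    BackStep mach (del1 rtab) (del2 rtab) mu mu w c' c ↔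
    ∃ d1 d2 : Bool, st1 c' = st2 c' ∧ st1 c = st2 c ∧
      rtab (st1 c') (tape w c.i) (tape w c.j) = some (st1 c, d1, d2) ∧
      c'.i = c.i + (cond d1 1 0) ∧ c.j = c'.j + (cond d2 1 0) := by
  unfold BackStep
  refine exists_congr fun d1 => exists_congr fun d2 => ?_
  have := joint rtab c'.p c'.q c.p c.q (tape w c.i) (tape w c.j) d1 d2
  constructor
  · rintro ⟨h1, h2, h3⟩
    obtain ⟨g1, g2, g3⟩ := this.1 ⟨h1, h2⟩
    exact ⟨g1, g2, g3, h3⟩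
  · rintro ⟨g1, g2, g3, h3⟩
    obtain ⟨h1, h2⟩ := this.2 ⟨g1, g2, g3⟩
    exact ⟨h1, h2, h3⟩

theorem mach_rev : Reversible mach := by
  refine ⟨⟨del1 rtab, del2 rtab, mu, mu, ?_⟩⟩
  intro w c c'
  rw [back_iff, step_iff]
  refine exists_congr fun d1 => exists_congr fun d2 => ?_
  rw [tab_rtab]
  tauto

theorem tab_cases : ∀ (s s' : Fin 4) (x y : TSym Bool) (d1 d2 : Bool),
    tab s x y = some (s', d1, d2) →
      (s = 0 ∧ s' = 1 ∧ x = .inr false ∧ y = .inr true ∧ d1 = false ∧ d2 = true) ∨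
      (s = 1 ∧ s' = 1 ∧ (x = .inr false ∨ x = .inl false) ∧ y = .inl true ∧ d1 = true ∧ d2 = true) ∨
      (s = 1 ∧ s' = 2 ∧ x = .inl false ∧ y = .inl false ∧ d1 = true ∧ d2 = true) ∨
      (s = 2 ∧ s' = 2 ∧ x = .inl true ∧ y = .inl false ∧ d1 = true ∧ d2 = true) ∨
      (s = 2 ∧ s' = 3 ∧ x = .inl true ∧ y = .inr false ∧ d1 = false ∧ d2 = false) := by
  intro s s' x y d1 d2 h
  unfold tab at h
  split at h <;> simp at h <;> obtain ⟨rfl, rfl, rfl⟩ := h <;> simp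

/-- The invariant. -/
def Inv (w : List Bool) (σ : Fin 4) (i j : ℕ) : Prop :=
  (σ = 0 → i = 0 ∧ j = w.length + 1) ∧
  (σ = 1 → i + j = w.length ∧ (∀ x, 1 ≤ x → x < i → tape w x = .inl false) ∧
    ∀ x < i, tape w (w.length - x) = .inl true) ∧
  (σ = 2 → i + j = w.length ∧ ∃ k, 1 ≤ k ∧ k < i ∧ (∀ x, 1 ≤ x → x ≤ k → tape w x = .inl false) ∧
    (∀ x, k < x → x < i → tape w x = .inl true) ∧
    (∀ x < k, tape w (w.length - x) = .inl true) ∧ tape w (w.length - k) = .inl false) ∧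
  (σ = 3 → w ∈ Lab)

theorem lab_of_tape (w : List Bool) (k : ℕ) (hk : 1 ≤ k) (hl : w.length = 2 * k)
    (h1 : ∀ x, 1 ≤ x → x ≤ k → tape w x = .inl false)
    (h2 : ∀ x, k < x → x ≤ 2 * k → tape w x = .inl true) : w ∈ Lab := by
  refine ⟨k, hk, ?_⟩
  apply List.ext_getElem
  · simp; omega
  · intro x hx1 hx2
    have := WKSim.tape_mid w x hx1
    by_cases hx : x < k
    · rw [h1 (x + 1) (by omega) (by omega)] at this
      rw [← Sum.inl.inj this, List.getElem_append_left (by simpa using hx)]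
      simp
    · rw [h2 (x + 1) (by omega) (by omega)] at this
      rw [← Sum.inl.inj this, List.getElem_append_right (by simpa using hx)]
      simp

theorem inv_step (w : List Bool) (s s' : Fin 4) (i j i' j' : ℕ) (d1 d2 : Bool)
    (hI : Inv w s i j) (ht : tab s (tape w i) (tape w j) = some (s', d1, d2))
    (hi : i' = i + cond d1 1 0) (hj : j = j' + cond d2 1 0) : Inv w s' i' j' := by
  obtain ⟨I0, I1, I2, I3⟩ := hI
  rcases tab_cases _ _ _ _ _ _ ht with ⟨rfl, rfl, hx, hy, rfl, rfl⟩ | ⟨rfl, rfl, hx, hy, rfl, rfl⟩ |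
    ⟨rfl, rfl, hx, hy, rfl, rfl⟩ | ⟨rfl, rfl, hx, hy, rfl, rfl⟩ | ⟨rfl, rfl, hx, hy, rfl, rfl⟩
  · obtain ⟨rfl, rfl⟩ := I0 rfl
    simp at hi hj
    refine ⟨by simp, fun _ => ⟨by omega, fun x h1 h2 => by omega, fun x h => by omega⟩, by simp,
      by simp⟩
  · obtain ⟨h1, h2, h3⟩ := I1 rfl
    simp only [cond_true] at hi hj
    refine ⟨by simp, fun _ => ⟨by omega, fun x hx1 hx2 => ?_, fun x hx1 => ?_⟩, by simp, by simp⟩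
    · by_cases hxi : x = i
      · subst hxi
        rcases hx with hx | hx
        · rw [WKSim.tape_left_iff] at hx; omega
        · exact hx
      · exact h2 x hx1 (by omega)
    · by_cases hxi : x = i
      · subst hxi
        rw [show w.length - x = j by omega]; exact hy
      · exact h3 x (by omega)
  · obtain ⟨h1, h2, h3⟩ := I1 rfl
    simp only [cond_true] at hi hj
    have hi0 : i ≠ 0 := by
      rintro rfl; rw [WKSim.tape_zero] at hx; cases hx
    refine ⟨by simp, by simp, fun _ => ⟨by omega, i, by omega, by omega, fun x hx1 hx2 => ?_,
      fun x hx1 hx2 => by omega, h3, ?_⟩, by simp⟩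
    · by_cases hxi : x = i
      · subst hxi; exact hx
      · exact h2 x hx1 (by omega)
    · rw [show w.length - i = j by omega]; exact hy
  · obtain ⟨h1, k, h2, h3, h4, h5, h6, h7⟩ := I2 rfl
    simp only [cond_true] at hi hj
    refine ⟨by simp, by simp, fun _ => ⟨by omega, k, h2, by omega, h4, fun x hx1 hx2 => ?_, h6, h7⟩,
      by simp⟩
    by_cases hxi : x = i
    · subst hxi; exact hx
    · exact h5 x hx1 (by omega)
  · obtain ⟨h1, k, h2, h3, h4, h5, h6, h7⟩ := I2 rfl
    refine ⟨by simp, by simp, by simp, fun _ => ?_⟩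
    rw [WKSim.tape_left_iff] at hy
    have h5' : ∀ x, k < x → x ≤ w.length → tape w x = .inl true := by
      intro x hx1 hx2
      by_cases hxi : x = i
      · subst hxi; exact hx
      · exact h5 x hx1 (by omega)
    have a1 : w.length - k ≤ k := by
      by_contra hc
      rw [h5' _ (by omega) (by omega)] at h7; cases h7
    have a2 : k < w.length - (k - 1) := by
      by_contra hc
      have := h6 (k - 1) (by omega)
      rw [h4 _ (by omega) (by omega)] at this; cases this
    have hl : w.length = 2 * k := by omega
    exact lab_of_tape w k h2 hl h4 (fun x hx1 hx2 => h5' x hx1 (by omega))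

theorem inv_all (w : List Bool) (c : Config mach)
    (h : Relation.ReflTransGen (Step mach w) (initConf mach w) c) :
    st1 c = st2 c ∧ Inv w (st1 c) c.i c.j := by
  induction h with
  | refl =>
    have h0 : st1 (initConf mach w) = 0 := rfl
    refine ⟨rfl, ?_⟩
    rw [h0]
    exact ⟨fun _ => ⟨rfl, rfl⟩, by simp, by simp, by simp⟩
  | tail _ hs ih =>
    obtain ⟨d1, d2, h1, h2, h3, h4, h5⟩ := (step_iff w _ _).1 hs
    exact ⟨h2, inv_step w _ _ _ _ _ _ d1 d2 ih.2 h3 h4 h5⟩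

def cf (s : Fin 4) (i j : ℕ) : Config mach := Config.mk (A := mach) s i s j

theorem cf_step (w : List Bool) (s s' : Fin 4) (i j i' j' : ℕ) (d1 d2 : Bool)
    (ht : tab s (tape w i) (tape w j) = some (s', d1, d2))
    (hi : i' = i + cond d1 1 0) (hj : j = j' + cond d2 1 0) :
    Step mach w (cf s i j) (cf s' i' j') :=
  (step_iff w _ _).2 ⟨d1, d2, rfl, rfl, ht, hi, hj⟩

theorem complete (n : ℕ) (hn : 1 ≤ n) (w : List Bool) (hl : w.length = 2 * n)
    (ha : ∀ x, 1 ≤ x → x ≤ n → tape w x = .inl false)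
    (hb : ∀ x, n < x → x ≤ 2 * n → tape w x = .inl true) :
    Relation.ReflTransGen (Step mach w) (initConf mach w) (cf 3 (2 * n) 0) := by
  have r1 : ∀ i ≤ n, Relation.ReflTransGen (Step mach w) (initConf mach w) (cf 1 i (2 * n - i)) := by
    intro i
    induction i with
    | zero =>
      intro _
      refine .single (cf_step w 0 1 0 (w.length + 1) 0 (2 * n - 0) false true ?_ rfl ?_)
      · rw [WKSim.tape_zero, WKSim.tape_right w _ le_rfl]; rfl
      · simp [hl]
    | succ i ih =>
      intro hi
      refine (ih (by omega)).tail (cf_step w 1 1 i _ _ _ true true ?_ rfl (by simp; omega))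
      rw [hb (2 * n - i) (by omega) (by omega)]
      rcases Nat.eq_zero_or_pos i with rfl | h
      · rfl
      · rw [ha i h (by omega)]; rfl
  have r2 : ∀ m < n, Relation.ReflTransGen (Step mach w) (initConf mach w)
      (cf 2 (n + 1 + m) (n - 1 - m)) := by
    intro m
    induction m with
    | zero =>
      intro _
      refine (r1 n le_rfl).tail (cf_step w 1 2 n _ _ _ true true ?_ rfl (by simp; omega))
      rw [show 2 * n - n = n by omega, ha n hn le_rfl]; rfl
    | succ m ih =>
      intro hm
      refine (ih (by omega)).tail (cf_step w 2 2 _ _ _ _ true true ?_ rfl (by simp; omega))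
      rw [hb (n + 1 + m) (by omega) (by omega), ha (n - 1 - m) (by omega) (by omega)]; rfl
  have r3 := r2 (n - 1) (by omega)
  rw [show n + 1 + (n - 1) = 2 * n by omega, show n - 1 - (n - 1) = 0 by omega] at r3
  refine r3.tail (cf_step w 2 3 _ _ _ _ false false ?_ rfl rfl)
  rw [hb _ (by omega) le_rfl, WKSim.tape_zero]; rfl

theorem lab_mem : Lab ∈ RevPWKLangs Bool := by
  refine ⟨mach, mach_rev, ?_⟩
  ext w
  change Accepts mach w ↔ _
  rw [WKSim.accepts_iff]
  constructor
  · rintro ⟨c, hr, _, ha⟩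
    obtain ⟨h1, h2⟩ := inv_all w c hr
    have h3 : st1 c = 3 := by
      rcases ha with ha | ha
      · exact ha
      · rw [h1]; exact ha
    exact h2.2.2.2 h3
  · rintro ⟨n, hn, rfl⟩
    refine ⟨cf 3 (2 * n) 0, complete n hn _ (by simp; omega) ?_ ?_, ?_, Or.inl rfl⟩
    · intro x hx1 hx2
      obtain ⟨x, rfl⟩ := Nat.exists_eq_add_of_le' hx1
      rw [WKSim.tape_mid _ x (by simp; omega), List.getElem_append_left (by simp; omega)]
      simp
    · intro x hx1 hx2
      obtain ⟨x, rfl⟩ := Nat.exists_eq_add_of_le' (show 1 ≤ x by omega)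
      rw [WKSim.tape_mid _ x (by simp; omega), List.getElem_append_right (by simp; omega)]
      simp
    · rintro ⟨c', hs⟩
      obtain ⟨d1, d2, _, _, h, _⟩ := (step_iff _ _ _).1 hs
      have h3 : st1 (cf 3 (2 * n) 0) = 3 := rfl
      rw [h3] at h
      rcases tab_cases _ _ _ _ _ _ h with h | h | h | h | h <;> exact absurd h.1 (by decide)

end WKLab

open WK in
/-- Neither `L·L` nor `L^*`, for `L = { aⁿbⁿ : n ≥ 1 }`, is
accepted by any deterministic two-party Watson-Crick system (reversible or not);
since `L` itself is accepted by a REV-PWK, the family of REV-PWK languages is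
not closed under concatenation or iteration. -/
theorem REV_PWK_not_closed_concat_star :
    (∀ A : DPWK Bool, lang A ≠ LabLab) ∧
    (∀ A : DPWK Bool, lang A ≠ LabStar) ∧
    Lab ∈ RevPWKLangs Bool := by
  exact ⟨WKSim.ne_lablab, WKSim.ne_labstar, WKLab.lab_mem⟩
end
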